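/- arXiv:2211.16595 — 4 statements merged into one kernel-verified Lean document; each statement's English description precedes it below -/
import Mathlib

section
/- Let p be a prime, n ≥ 2 an integer, and α = (α_1,…,α_{n−1}) a composition of length n−1 with α_i ≥ 2 for every i, and let t be an integer with 1 ≤ t ≤ n−1. For k ≥ 1, let α_{/k,t} denote the composition obtained from α by replacing its t-th entry α_t with k·α_t, and set γ = max{α_1,…,α_t}. Then there exists a constant C > 0 (depending on p, n, α and t, but not on k) such that g_{α_{/k,t}}(p) ≤ C·p^{γ·k·(n−2)} for all k ≥ 1. -/
/-- `v` lies in the ℤ-span of the columns of the square integer matrix `A`. -/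
def InColSpan {n : ℕ} (A : Matrix (Fin n) (Fin n) ℤ) (v : Fin n → ℤ) : Prop :=
  ∃ x : Fin n → ℤ, A.mulVec x = v

/-- `A` is a subring matrix: upper triangular in Hermite normal form (positive
diagonal, `0 ≤ A i j < A i i` for `i < j`), the all-ones vector lies in the
ℤ-span of the columns, and the componentwise product of any two columns lies in
the ℤ-span of the columns. -/
def IsSubringMatrix {n : ℕ} (A : Matrix (Fin n) (Fin n) ℤ) : Prop :=
  (∀ i j : Fin n, j < i → A i j = 0) ∧
  (∀ i : Fin n, 0 < A i i) ∧
  (∀ i j : Fin n, i < j → 0 ≤ A i j ∧ A i j < A i i) ∧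
  InColSpan A (fun _ => 1) ∧
  (∀ j k : Fin n, InColSpan A (fun i => A i j * A i k))

/-- `A` is an irreducible subring matrix for the prime `p` with diagonal
`(p ^ α 0, …, p ^ α (n-1), 1)`: a subring matrix with the prescribed diagonal,
whose last column has all entries equal to `1`, and all of whose off-diagonal
entries away from the last column are divisible by `p`. -/
def IsIrreducibleSubringMatrix (p : ℕ) {n : ℕ} (α : Fin n → ℕ)
    (A : Matrix (Fin (n + 1)) (Fin (n + 1)) ℤ) : Prop :=
  IsSubringMatrix A ∧
  (∀ i : Fin n, A i.castSucc i.castSucc = (p : ℤ) ^ α i) ∧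
  A (Fin.last n) (Fin.last n) = 1 ∧
  (∀ i : Fin (n + 1), A i (Fin.last n) = 1) ∧
  (∀ i j : Fin n, i < j → (p : ℤ) ∣ A i.castSucc j.castSucc)

/-- `gComp p α` : the number of irreducible subring matrices with diagonal
`(p ^ α 0, …, p ^ α (n-1), 1)`. -/
noncomputable def gComp (p : ℕ) {n : ℕ} (α : Fin n → ℕ) : ℕ :=
  Nat.card {A : Matrix (Fin (n + 1)) (Fin (n + 1)) ℤ // IsIrreducibleSubringMatrix p α A}

/-- `gNum p n e` : the number of irreducible subring matrices of size `n` with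
determinant `p ^ e` (so `gNum p 1 0 = 1` and `gNum p 1 e = 0` for `e ≥ 1`). -/
noncomputable def gNum (p : ℕ) : ℕ → ℕ → ℕ
  | 0, _ => 0
  | m + 1, e =>
      Nat.card {A : Matrix (Fin (m + 1)) (Fin (m + 1)) ℤ //
        (∃ α : Fin m → ℕ, (∀ i, 1 ≤ α i) ∧ IsIrreducibleSubringMatrix p α A) ∧
        A.det = (p : ℤ) ^ e}

/-- The entries of a subring matrix are bounded by the diagonal of their row. -/
theorem IsSubringMatrix.entry_mem_Ico {n : ℕ} {A : Matrix (Fin n) (Fin n) ℤ}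
    (hA : IsSubringMatrix A) {i j : Fin n} (hij : j ≠ i) : 0 ≤ A i j ∧ A i j < A i i := by
  obtain ⟨hlow, hpos, hup, -, -⟩ := hA
  rcases lt_or_gt_of_ne hij with h | h
  · rw [hlow i j h]
    exact ⟨le_rfl, hpos i⟩
  · exact hup i j h

/-- An irreducible subring matrix is determined by its off-diagonal entries away from the last
row and column, each of which is bounded by the diagonal entry of its row. -/
theorem gComp_le_prod (p : ℕ) {m : ℕ} (β : Fin m → ℕ) :
    gComp p β ≤ ∏ i, (p ^ β i) ^ (m - 1) := by
  have hlt (A : {A : Matrix (Fin (m + 1)) (Fin (m + 1)) ℤ // IsIrreducibleSubringMatrix p β A})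
      (i : Fin m) (j : {j : Fin m // j ≠ i}) :
      (A.1 i.castSucc j.1.castSucc).toNat < p ^ β i := by
    have hb := A.2.1.entry_mem_Ico (i := i.castSucc) (j := j.1.castSucc)
      (fun h => j.2 (Fin.castSucc_injective m h))
    rw [Int.toNat_lt hb.1]
    push_cast
    exact (A.2.2.1 i) ▸ hb.2
  let f : {A : Matrix (Fin (m + 1)) (Fin (m + 1)) ℤ // IsIrreducibleSubringMatrix p β A} →
      ((i : Fin m) → {j : Fin m // j ≠ i} → Fin (p ^ β i)) :=
    fun A i j => ⟨(A.1 i.castSucc j.1.castSucc).toNat, hlt A i j⟩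
  have hf : Function.Injective f := by
    intro A B h
    ext i j
    induction j using Fin.lastCases with
    | last => rw [A.2.2.2.2.1 i, B.2.2.2.2.1 i]
    | cast j =>
      induction i using Fin.lastCases with
      | last => rw [A.2.1.1 _ _ (Fin.castSucc_lt_last j), B.2.1.1 _ _ (Fin.castSucc_lt_last j)]
      | cast i =>
        by_cases hij : j = i
        · rw [hij, A.2.2.1 i, B.2.2.1 i]
        · have hne : j.castSucc ≠ i.castSucc := fun h => hij (Fin.castSucc_injective m h)
          have h1 := (A.2.1.entry_mem_Ico hne).1
          have h2 := (B.2.1.entry_mem_Ico hne).1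
          have h3 : (A.1 i.castSucc j.castSucc).toNat = (B.1 i.castSucc j.castSucc).toNat :=
            congrArg Fin.val (congrFun (congrFun h i) ⟨j, hij⟩)
          omega
  refine (Nat.card_le_card_of_injective f hf).trans_eq ?_
  simp [Nat.card_eq_fintype_card, Fintype.card_subtype_compl]

theorem g_growth_bound (p : ℕ) (hp : p.Prime) (n : ℕ) (hn : 2 ≤ n)
    (α : Fin (n - 1) → ℕ) (hα : ∀ i, 2 ≤ α i) (t : Fin (n - 1)) :
    ∃ C : ℝ, 0 < C ∧ ∀ k : ℕ, 1 ≤ k →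
      (gComp p (Function.update α t (k * α t)) : ℝ) ≤
        C * (p : ℝ) ^ ((Finset.Iic t).sup α * k * (n - 2)) := by
  have hp0 := hp.pos
  refine ⟨((∏ i ∈ Finset.univ.erase t, (p ^ α i) ^ (n - 2) : ℕ) : ℝ), ?_, fun k _ => ?_⟩
  · exact_mod_cast Finset.prod_pos fun i _ => by positivity
  · have hle : α t ≤ (Finset.Iic t).sup α := Finset.le_sup (Finset.mem_Iic.2 le_rfl)
    have key : gComp p (Function.update α t (k * α t)) ≤
        (∏ i ∈ Finset.univ.erase t, (p ^ α i) ^ (n - 2)) *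
          p ^ ((Finset.Iic t).sup α * k * (n - 2)) := by
      refine (gComp_le_prod p _).trans ?_
      rw [← Finset.prod_erase_mul _ _ (Finset.mem_univ t), Nat.sub_sub, Function.update_self,
        ← pow_mul]
      refine Nat.mul_le_mul (Finset.prod_congr rfl fun i hi => ?_).le
        (Nat.pow_le_pow_right hp0 ?_)
      · rw [Function.update_of_ne (Finset.ne_of_mem_erase hi)]
      · rw [mul_comm k]
        gcongr
    exact_mod_cast key
end

section
/- Let p be a prime, n ≥ 2 an integer, and β = (β_1,…,β_{n−1}) a composition of length n−1 with β_1 ≥ 2, β_i ≥ 1 for all i, and β_1 + β_2 + ⋯ + β_{n−1} > n. Set m_β = min{⌊β_1/2⌋, β_2, …, β_{n−1}}. Then g_β(p) ≥ p^{(n−2)·m_β}. -/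
/-- The upper-triangular matrix with diagonal `D`, first row `a` and zeros elsewhere, except that
its last column is the all-ones vector. -/
def firstRowMatrix {k : ℕ} (D a : Fin (k + 2) → ℤ) : Matrix (Fin (k + 2)) (Fin (k + 2)) ℤ :=
  fun i j => if j = Fin.last (k + 1) then 1 else if i = 0 then a j else if i = j then D j else 0

theorem isSubringMatrix_firstRowMatrix {k : ℕ} {D a : Fin (k + 2) → ℤ}
    (hD : ∀ i, i ≠ Fin.last _ → 1 < D i) (ha0 : a 0 = D 0)
    (ha : ∀ j, j ≠ 0 → 0 ≤ a j ∧ a j < D 0)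
    (hmul : ∀ i j, i ≠ 0 → j ≠ 0 → D 0 ∣ a i * a j) (hdiag : ∀ j, j ≠ 0 → D 0 ∣ a j * D j) :
    IsSubringMatrix (firstRowMatrix D a) := by
  have hl0 : (0 : Fin (k + 2)) ≠ Fin.last (k + 1) := Fin.last_pos.ne
  have hmul' : ∀ i j, i ≠ j → D 0 ∣ a i * a j := by
    intro i j hij
    by_cases hi : i = 0
    · subst hi; rw [ha0]; exact dvd_mul_right _ _
    by_cases hj : j = 0
    · subst hj; rw [ha0]; exact dvd_mul_left _ _
    exact hmul i j hi hj
  have hsq : ∀ j, D 0 ∣ a j * a j - a j * D j := by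
    intro j
    by_cases hj : j = 0
    · subst hj; rw [ha0]; simp
    exact dvd_sub (hmul j j hj hj) (hdiag j hj)
  have hcol : ∀ j (c : ℤ), (firstRowMatrix D a).mulVec (Pi.single j c) =
      fun i => firstRowMatrix D a i j * c := by
    intro j c; ext i; simp [Matrix.col]
  refine ⟨?_, ?_, ?_, ⟨Pi.single (Fin.last _) 1, ?_⟩, ?_⟩
  · intro i j hij
    have h1 : j ≠ Fin.last (k + 1) := (hij.trans_le (Fin.le_last i)).ne
    have h2 : i ≠ 0 := (Fin.zero_le j |>.trans_lt hij).ne'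
    simp [firstRowMatrix, h1, h2, hij.ne']
  · intro i
    by_cases h1 : i = Fin.last (k + 1)
    · simp [firstRowMatrix, h1]
    by_cases h2 : i = 0
    · subst h2; simpa [firstRowMatrix, h1, ha0] using zero_lt_one.trans (hD 0 h1)
    simpa [firstRowMatrix, h1, h2] using zero_lt_one.trans (hD i h1)
  · intro i j hij
    have h1 : i ≠ Fin.last (k + 1) := (hij.trans_le (Fin.le_last j)).ne
    have h2 : j ≠ 0 := (Fin.zero_le i |>.trans_lt hij).ne'
    have hDi := hD i h1
    by_cases hj : j = Fin.last (k + 1)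
    · by_cases hi : i = 0
      · subst hi; simpa [firstRowMatrix, h1, hj, ha0] using hDi
      · simpa [firstRowMatrix, h1, hj, hi] using hDi
    · by_cases hi : i = 0
      · subst hi; simpa [firstRowMatrix, h1, hj, ha0] using ha j h2
      · simpa [firstRowMatrix, h1, hj, hi, hij.ne] using zero_lt_one.trans hDi
  · rw [hcol]; simp [firstRowMatrix]
  · intro j l
    by_cases hj : j = Fin.last (k + 1)
    · exact ⟨Pi.single l 1, by rw [hcol]; ext i; simp [firstRowMatrix, hj]⟩
    by_cases hl : l = Fin.last (k + 1)
    · exact ⟨Pi.single j 1, by rw [hcol]; ext i; simp [firstRowMatrix, hl]⟩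
    by_cases hjl : j = l
    · subst hjl
      obtain ⟨q, hq⟩ := hsq j
      refine ⟨Pi.single j (D j) + Pi.single 0 q, ?_⟩
      rw [Matrix.mulVec_add, hcol, hcol]
      ext i
      by_cases hi : i = 0
      · simp only [firstRowMatrix, Pi.add_apply, hj, hl0, hi, ha0, if_true, if_false]
        linarith
      · by_cases hij : i = j
        · subst hij; simp [firstRowMatrix, hj, hl0, hi]
        · simp [firstRowMatrix, hj, hl0, hi, hij]
    · obtain ⟨q, hq⟩ := hmul' j l hjl
      refine ⟨Pi.single 0 q, ?_⟩
      rw [hcol]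
      ext i
      by_cases hi : i = 0
      · simp [firstRowMatrix, hj, hl, hl0, hi, ha0, hq]
      · by_cases hij : i = j
        · subst hij; simp [firstRowMatrix, hj, hl, hl0, hi, hjl]
        · simp [firstRowMatrix, hj, hl, hl0, hi, hij]

theorem finite_isIrreducibleSubringMatrix (p : ℕ) {n : ℕ} (α : Fin n → ℕ) :
    Finite {A : Matrix (Fin (n + 1)) (Fin (n + 1)) ℤ // IsIrreducibleSubringMatrix p α A} := by
  let B : Fin (n + 1) → Fin (n + 1) → ℤ := fun i _ =>
    Fin.lastCases (motive := fun _ => ℤ) 1 (fun i => (p : ℤ) ^ α i) i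
  refine Set.Finite.subset (Set.finite_Icc (0 : Fin (n + 1) → Fin (n + 1) → ℤ) B) ?_
  rintro A ⟨⟨hlow, hpos, hbd, -, -⟩, hd, hlast, -, -⟩
  have hB : ∀ i j, B i j = A i i := by
    intro i j
    cases i using Fin.lastCases with
    | last => simp [B, hlast]
    | cast i => simp [B, hd]
  have key : ∀ i j, 0 ≤ A i j ∧ A i j ≤ A i i := by
    intro i j
    rcases lt_trichotomy i j with h | rfl | h
    · exact ⟨(hbd i j h).1, (hbd i j h).2.le⟩
    · exact ⟨(hpos i).le, le_rfl⟩
    · rw [hlow i j h]; exact ⟨le_rfl, (hpos i).le⟩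
  exact ⟨fun i j => (key i j).1, fun i j => (key i j).2.trans_eq (hB i j).symm⟩

theorem pow_le_gComp {p : ℕ} (hp : p.Prime) {k m : ℕ} {β : Fin (k + 1) → ℕ}
    (hpos : ∀ i, 1 ≤ β i) (hm0 : 2 * m ≤ β 0) (hm : ∀ i, i ≠ 0 → m ≤ β i) :
    p ^ (k * m) ≤ gComp p β := by
  have hp0 : (0 : ℤ) < p := by exact_mod_cast hp.pos
  have hp1 : (1 : ℤ) < p := by exact_mod_cast hp.one_lt
  have hβ0 := hpos 0
  let D : Fin (k + 2) → ℤ := Fin.snoc (fun i => (p : ℤ) ^ β i) 1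
  let a : (Fin k → Fin (p ^ m)) → Fin (k + 2) → ℤ := fun c =>
    Fin.cons ((p : ℤ) ^ β 0)
      (fun j => (p : ℤ) ^ (β 0 - m) * Fin.snoc (α := fun _ => ℤ) (fun i => (c i : ℤ)) 0 j)
  have hDcast : ∀ i : Fin (k + 1), D i.castSucc = (p : ℤ) ^ β i := fun i => by simp [D]
  have hD0 : D 0 = (p : ℤ) ^ β 0 := hDcast 0
  have ha_dvd : ∀ c j, j ≠ 0 → (p : ℤ) ^ (β 0 - m) ∣ a c j := by
    intro c j hj
    obtain ⟨j, rfl⟩ := Fin.exists_succ_eq.2 hj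
    exact ⟨_, Fin.cons_succ _ _ _⟩
  have ha_last : ∀ c, a c (Fin.last _) = 0 := by
    intro c
    rw [← Fin.succ_last]
    simp [a]
  have ha_mid : ∀ c (i : Fin k), a c i.castSucc.succ = (p : ℤ) ^ (β 0 - m) * (c i : ℤ) := by
    intro c i
    simp [a]
  have hsub : ∀ c, IsSubringMatrix (firstRowMatrix D (a c)) := by
    intro c
    refine isSubringMatrix_firstRowMatrix ?_ ?_ ?_ ?_ ?_
    · intro i hi
      obtain ⟨i, rfl⟩ := Fin.exists_castSucc_eq.2 hi
      rw [hDcast]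
      exact one_lt_pow₀ hp1 (by have := hpos i; omega)
    · rw [hD0]; simp [a]
    · intro j hj
      obtain ⟨j, rfl⟩ := Fin.exists_succ_eq.2 hj
      rw [hD0]
      cases j using Fin.lastCases with
      | last => rw [Fin.succ_last, ha_last]; exact ⟨le_rfl, by positivity⟩
      | cast i =>
        rw [ha_mid]
        refine ⟨by positivity, ?_⟩
        have h : (c i : ℤ) < (p : ℤ) ^ m := by exact_mod_cast (c i).2
        calc _ < (p : ℤ) ^ (β 0 - m) * (p : ℤ) ^ m := by gcongr
          _ = _ := by rw [← pow_add]; congr 1; omega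
    · intro i j hi hj
      rw [hD0]
      refine dvd_trans ?_ (mul_dvd_mul (ha_dvd c i hi) (ha_dvd c j hj))
      rw [← pow_add]
      exact pow_dvd_pow _ (by omega)
    · intro j hj
      cases j using Fin.lastCases with
      | last => simp [ha_last]
      | cast j =>
        rw [hD0, hDcast]
        have hj' : j ≠ 0 := fun h => hj (by simp [h])
        refine dvd_trans ?_ (mul_dvd_mul (ha_dvd c _ hj) (pow_dvd_pow _ (hm j hj')))
        rw [← pow_add]
        exact pow_dvd_pow _ (by omega)
  have hirr : ∀ c, IsIrreducibleSubringMatrix p β (firstRowMatrix D (a c)) := by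
    intro c
    refine ⟨hsub c, ?_, by simp [firstRowMatrix], by simp [firstRowMatrix], ?_⟩
    · intro i
      by_cases hi : i = 0
      · subst hi; simp [firstRowMatrix, a, Fin.last_pos.ne]
      · simp [firstRowMatrix, hi, hDcast, (Fin.castSucc_lt_last i).ne]
    · intro i j hij
      have hj : j.castSucc ≠ 0 := by
        rw [Ne, Fin.castSucc_eq_zero_iff]
        exact ((Fin.zero_le i).trans_lt hij).ne'
      have h : (p : ℤ) ∣ a c j.castSucc :=
        (dvd_pow_self _ (by omega)).trans (ha_dvd c _ hj)
      by_cases hi : i = 0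
      · simpa [firstRowMatrix, hi, (Fin.castSucc_lt_last j).ne] using h
      · simp [firstRowMatrix, hi, (Fin.castSucc_lt_last j).ne, hij.ne]
  have hinj : Function.Injective fun c : Fin k → Fin (p ^ m) =>
      (⟨firstRowMatrix D (a c), hirr c⟩ :
        {A : Matrix (Fin (k + 2)) (Fin (k + 2)) ℤ // IsIrreducibleSubringMatrix p β A}) := by
    intro c c' h
    ext i
    have h' := congrFun (congrFun (congrArg Subtype.val h) 0) i.castSucc.succ
    have hne : i.castSucc.succ ≠ Fin.last (k + 1) := by
      rw [Fin.succ_castSucc]; exact (Fin.castSucc_lt_last _).ne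
    simp only [firstRowMatrix, if_neg hne, if_true, ha_mid] at h'
    exact_mod_cast mul_left_cancel₀ (pow_pos hp0 _).ne' h'
  have := finite_isIrreducibleSubringMatrix p β
  calc p ^ (k * m) = Nat.card (Fin k → Fin (p ^ m)) := by
        simp [← pow_mul, mul_comm]
    _ ≤ gComp p β := Nat.card_le_card_of_injective _ hinj

theorem g_lower_bound_min (p : ℕ) (hp : p.Prime) (n : ℕ) (hn : 2 ≤ n)
    (β : Fin (n - 1) → ℕ) (hpos : ∀ i, 1 ≤ β i) (hfirst : 2 ≤ β ⟨0, by omega⟩)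
    (hsum : n < ∑ i, β i) :
    p ^ ((n - 2) *
        Finset.univ.inf' ⟨⟨0, by omega⟩, Finset.mem_univ _⟩
          (fun i : Fin (n - 1) => if i.val = 0 then β i / 2 else β i))
      ≤ gComp p β := by
  obtain ⟨k, rfl⟩ : ∃ k, n = k + 2 := ⟨n - 2, by omega⟩
  refine pow_le_gComp (k := k) (β := β) hp hpos ?_ ?_
  · have h := Finset.inf'_le (fun i : Fin (k + 1) => if i.val = 0 then β i / 2 else β i)
      (Finset.mem_univ 0)
    exact (Nat.mul_le_mul_left 2 h).trans (Nat.mul_div_le _ _)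
  · intro i hi
    have h := Finset.inf'_le (fun i : Fin (k + 1) => if i.val = 0 then β i / 2 else β i)
      (Finset.mem_univ i)
    exact h.trans_eq (if_neg (Fin.val_ne_zero_iff.2 hi))
end

section
/- Let p be a prime, n ≥ 4 an integer, k an integer with 2 ≤ k ≤ n−2, β ≥ 2 an integer, and set r = n−1−k. Let α be the composition of length n−1 with α_1 = 2, α_k = 2, α_{n−1} = β, and α_i = 1 for all other indices i. Then g_α(p) = p^{n−3+r} + r·(p−1)·p^{n−3}. -/
/-- The square matrix with last column `1` and last row `(0, …, 0, 1)` whose remaining block is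
`p` times the diagonal matrix of `t` with `a` added to row `z` and `b` added to row `K`. -/
def twoRowMatrix {m : ℕ} (p : ℤ) (z K : Fin m) (t a b : Fin m → ℤ) :
    Matrix (Fin (m + 1)) (Fin (m + 1)) ℤ := fun i j =>
  Fin.lastCases (motive := fun _ => ℤ) 1 (fun j => Fin.lastCases (motive := fun _ => ℤ) 0
    (fun i => p * ((if i = j then t i else 0) + (if i = z then a j else 0) +
      (if i = K then b j else 0))) i) j

section twoRowMatrix

variable {m : ℕ} {p : ℤ} {z K : Fin m} {t a b : Fin m → ℤ}

@[simp] lemma twoRowMatrix_last_right (i : Fin (m + 1)) :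
    twoRowMatrix p z K t a b i (Fin.last m) = 1 := by
  simp [twoRowMatrix]

@[simp] lemma twoRowMatrix_last_castSucc (j : Fin m) :
    twoRowMatrix p z K t a b (Fin.last m) j.castSucc = 0 := by
  simp [twoRowMatrix]

@[simp] lemma twoRowMatrix_castSucc_castSucc (i j : Fin m) :
    twoRowMatrix p z K t a b i.castSucc j.castSucc =
      p * ((if i = j then t i else 0) + (if i = z then a j else 0) +
        (if i = K then b j else 0)) := by
  simp [twoRowMatrix]

lemma twoRowMatrix_mulVec_last (x : Fin (m + 1) → ℤ) :
    (twoRowMatrix p z K t a b).mulVec x (Fin.last m) = x (Fin.last m) := by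
  simp [Matrix.mulVec, dotProduct, Fin.sum_univ_castSucc]

lemma twoRowMatrix_mulVec_castSucc (x : Fin (m + 1) → ℤ) (i : Fin m) :
    (twoRowMatrix p z K t a b).mulVec x i.castSucc =
      p * (t i * x i.castSucc + (if i = z then ∑ j, a j * x j.castSucc else 0) +
        (if i = K then ∑ j, b j * x j.castSucc else 0)) + x (Fin.last m) := by
  simp only [Matrix.mulVec, dotProduct, Fin.sum_univ_castSucc, twoRowMatrix_castSucc_castSucc,
    twoRowMatrix_last_right, one_mul, mul_assoc, ← Finset.mul_sum, add_mul,
    Finset.sum_add_distrib, ite_mul, zero_mul]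
  congr 3
  · congr 1
    · simp
    · split_ifs <;> simp
  · split_ifs <;> simp

lemma inColSpan_column {n : ℕ} (A : Matrix (Fin n) (Fin n) ℤ) (j : Fin n) :
    InColSpan A (fun i => A i j) :=
  ⟨Pi.single j 1, by ext i; simp⟩

/-- The sums occurring in rows `z` and `K` when a product of two columns is expanded. -/
lemma sum_mul_of_eq_off_pair {c y : Fin m → ℤ} {j k : Fin m} (hzK : z ≠ K) (hc : c z = 0)
    (hy : ∀ l, l ≠ z → l ≠ K → y l = if j = l ∧ k = l then p * t l else 0) :
    ∑ l, c l * y l = c K * y K + if k = j ∧ j ≠ K then p * t j * c j else 0 := by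
  have h : ∀ l, c l * y l = (if l = K then c K * y K else 0) +
      (if l = j then (if k = l ∧ l ≠ K then p * t l * c l else 0) else 0) := by
    intro l
    by_cases h1 : l = K
    · subst h1; simp
    · by_cases h2 : l = z
      · subst h2; simp [hc, h1]
      · rw [hy l h2 h1]
        simp only [h1, if_false, eq_comm (a := j) (b := l)]
        split_ifs <;> simp_all
        ring
  rw [Finset.sum_congr rfl fun l _ => h l, Finset.sum_add_distrib]
  simp

lemma inColSpan_twoRowMatrix_mul_iff (hp : p ≠ 0) (hzK : z ≠ K) (ht : ∀ i, t i ≠ 0)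
    (htz : t z = p) (htK : t K = p) (haz : a z = 0) (hbz : b z = 0) (hbK : b K = 0)
    (j k : Fin m) :
    InColSpan (twoRowMatrix p z K t a b) (fun i =>
      twoRowMatrix p z K t a b i j.castSucc * twoRowMatrix p z K t a b i k.castSucc) ↔
    p ∣ a K * (b j * b k - if k = j then t j * b j else 0) := by
  have hb : ∀ y : Fin m → ℤ, (∀ l, l ≠ z → l ≠ K → y l = if j = l ∧ k = l then p * t l else 0) →
      ∑ l, b l * y l = p * if k = j then t j * b j else 0 := by
    intro y hy
    rw [sum_mul_of_eq_off_pair hzK hbz hy, hbK]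
    by_cases h : j = K
    · subst h; simp [hbK]
    · simp [h, mul_assoc]
  have hcong : p ∣ a K * (((if K = j then p else 0) + b j) * ((if K = k then p else 0) + b k) -
        if k = j then t j * b j else 0) ↔
      p ∣ a K * (b j * b k - if k = j then t j * b j else 0) := by
    apply dvd_iff_dvd_of_dvd_sub
    rw [← mul_sub]
    refine Dvd.dvd.mul_left ?_ _
    split_ifs
    · exact ⟨p + b j + b k, by ring⟩
    · exact ⟨p + b j + b k, by ring⟩
    · exact ⟨b k, by ring⟩
    · exact ⟨b k, by ring⟩
    · exact ⟨b j, by ring⟩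
    · exact ⟨b j, by ring⟩
    · exact ⟨0, by ring⟩
    · exact ⟨0, by ring⟩
  constructor
  · rintro ⟨x, hx⟩
    have hlast : x (Fin.last m) = 0 := by
      have := congrFun hx (Fin.last m)
      rw [twoRowMatrix_mulVec_last] at this
      simpa using this
    have hrow : ∀ i : Fin m, t i * x i.castSucc +
        (if i = z then ∑ j, a j * x j.castSucc else 0) +
        (if i = K then ∑ j, b j * x j.castSucc else 0) =
        p * (((if i = j then t i else 0) + (if i = z then a j else 0) +
          (if i = K then b j else 0)) * ((if i = k then t i else 0) +
          (if i = z then a k else 0) + (if i = K then b k else 0))) := by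
      intro i
      have := congrFun hx i.castSucc
      rw [twoRowMatrix_mulVec_castSucc, hlast] at this
      simp only [twoRowMatrix_castSucc_castSucc] at this
      apply mul_left_cancel₀ hp
      linear_combination this
    have hy : ∀ l, l ≠ z → l ≠ K →
        x l.castSucc = if j = l ∧ k = l then p * t l else 0 := by
      intro l hlz hlK
      have := hrow l
      simp only [hlz, hlK, if_false, add_zero] at this
      apply mul_left_cancel₀ (ht l)
      rw [this]
      simp only [eq_comm (a := l)]
      split_ifs <;> simp_all
      ring
    have hK := hrow K
    rw [hb _ hy, htK] at hK
    simp only [hzK.symm, if_false, if_true, add_zero] at hK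
    have hK' : x K.castSucc = ((if K = j then p else 0) + b j) * ((if K = k then p else 0) + b k) -
        if k = j then t j * b j else 0 := by
      apply mul_left_cancel₀ hp
      linear_combination hK
    have hz := hrow z
    rw [sum_mul_of_eq_off_pair hzK haz hy, htz] at hz
    simp only [hzK, if_false, if_true, add_zero] at hz
    have hd : p ∣ a K * x K.castSucc := by
      have h2 : p ∣ if k = j ∧ j ≠ K then p * t j * a j else 0 := by
        split_ifs
        · exact ⟨t j * a j, by ring⟩
        · simp
      have h3 : p ∣ p * x z.castSucc + (a K * x K.castSucc +
          if k = j ∧ j ≠ K then p * t j * a j else 0) := ⟨_, hz⟩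
      exact (dvd_add_left h2).1 ((dvd_add_right (dvd_mul_right _ _)).1 h3)
    rw [hK'] at hd
    exact hcong.1 hd
  · intro h
    obtain ⟨c, hc⟩ := hcong.2 h
    set X := ((if K = j then p else 0) + b j) * ((if K = k then p else 0) + b k) -
        if k = j then t j * b j else 0 with hX
    let y : Fin m → ℤ := fun l =>
      if l = z then ((if z = j then p else 0) + a j) * ((if z = k then p else 0) + a k) - c -
        (if k = j ∧ j ≠ K then t j * a j else 0)
      else if l = K then X else if j = l ∧ k = l then p * t l else 0
    have hy : ∀ l, l ≠ z → l ≠ K → y l = if j = l ∧ k = l then p * t l else 0 := by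
      intro l h1 h2
      simp only [y, h1, h2, if_false]
    have hyK : y K = X := by simp [y, hzK.symm]
    refine ⟨Fin.snoc (α := fun _ => ℤ) y 0, ?_⟩
    ext i
    refine Fin.lastCases ?_ (fun i => ?_) i
    · rw [twoRowMatrix_mulVec_last]
      simp
    · rw [twoRowMatrix_mulVec_castSucc]
      simp only [twoRowMatrix_castSucc_castSucc, Fin.snoc_castSucc, Fin.snoc_last]
      rw [hb y hy, sum_mul_of_eq_off_pair hzK haz hy, hyK, hc]
      by_cases hiz : i = z
      · subst hiz
        simp only [hzK, if_false, if_true, htz, y]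
        split_ifs <;> ring
      · by_cases hiK : i = K
        · subst hiK
          simp only [hiz, if_false, if_true, htK, hyK, hX]
          split_ifs <;> ring
        · simp only [hiz, hiK, if_false, hy i hiz hiK, eq_comm (a := i)]
          split_ifs <;> simp_all
          ring

lemma forall_dvd_iff_mem_image {q : ℕ} (hq : q.Prime) {l : Fin m}
    (hKl : K < l) (htl : (q : ℤ) ∣ t l) (ht1 : ∀ i, K < i → i ≠ l → t i = 1)
    (haK : 0 ≤ a K ∧ a K < q) (hb0 : ∀ j, j ≤ K → b j = 0)
    (hb : ∀ j, K < j → 0 ≤ b j ∧ b j < q) :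
    (∀ j k, (q : ℤ) ∣ a K * (b j * b k - if k = j then t j * b j else 0)) ↔
      a K = 0 ∨ b ∈ (Finset.Ioi K).image
        (fun i => if i = l then (0 : Fin m → ℤ) else Pi.single i 1) := by
  have hqZ : Prime (q : ℤ) := Nat.prime_iff_prime_int.1 hq
  have small : ∀ x : ℤ, 0 ≤ x → x < q → (q : ℤ) ∣ x → x = 0 :=
    fun x h0 h1 h => Int.eq_zero_of_dvd_of_nonneg_of_lt h0 h1 h
  have hbnn : ∀ j, 0 ≤ b j ∧ b j < q := by
    intro j
    rcases le_or_gt j K with h | h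
    · rw [hb0 j h]; exact ⟨le_rfl, by exact_mod_cast hq.pos⟩
    · exact hb j h
  constructor
  · intro h
    by_cases haK0 : a K = 0
    · exact Or.inl haK0
    right
    have h' : ∀ j k, (q : ℤ) ∣ b j * b k - if k = j then t j * b j else 0 := fun j k =>
      (hqZ.dvd_or_dvd (h j k)).resolve_left fun hd => haK0 (small _ haK.1 haK.2 hd)
    have hbl : b l = 0 := by
      have h1 := h' l l
      rw [if_pos rfl] at h1
      have h2 := (dvd_sub_left (htl.mul_right (b l))).1 h1
      exact small _ (hbnn l).1 (hbnn l).2 (or_self_iff.1 (hqZ.dvd_or_dvd h2))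
    rw [Finset.mem_image]
    by_cases hall : ∀ i, b i = 0
    · exact ⟨l, Finset.mem_Ioi.2 hKl, by ext i; simp [hall i]⟩
    · push Not at hall
      obtain ⟨i, hi⟩ := hall
      have hil : i ≠ l := fun h => hi (h ▸ hbl)
      have hKi : K < i := not_le.1 fun h => hi (hb0 i h)
      refine ⟨i, Finset.mem_Ioi.2 hKi, ?_⟩
      rw [if_neg hil]
      ext k
      by_cases hk : k = i
      · subst hk
        have h1 := h' k k
        rw [if_pos rfl, ht1 k hKi hil, ← sub_mul] at h1
        have h2 := (hqZ.dvd_or_dvd h1).resolve_right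
          fun hd => hi (small _ (hbnn k).1 (hbnn k).2 hd)
        have h3 := small (b k - 1) (by have := (hbnn k).1; omega)
          (by have := (hbnn k).2; omega) h2
        simp; omega
      · have h1 := h' i k
        rw [if_neg hk, sub_zero] at h1
        have h2 := (hqZ.dvd_or_dvd h1).resolve_left
          fun hd => hi (small _ (hbnn i).1 (hbnn i).2 hd)
        rw [small _ (hbnn k).1 (hbnn k).2 h2]
        simp [hk]
  · rintro (h | h) j k
    · simp [h]
    · obtain ⟨i, hi, rfl⟩ := Finset.mem_image.1 h
      by_cases hil : i = l
      · simp [hil]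
      · have := ht1 i (Finset.mem_Ioi.1 hi) hil
        rw [if_neg hil]
        by_cases hji : j = i
        · subst hji
          by_cases hki : k = j
          · simp [hki, this]
          · simp [hki]
        · simp [hji]

/-- The pairs of rows that give an irreducible subring matrix. -/
structure IsAdmissiblePair (p : ℤ) (z K : Fin m) (t a b : Fin m → ℤ) : Prop where
  left_z : a z = 0
  left_bound : ∀ j, j ≠ z → 0 ≤ a j ∧ a j < p
  right_zero : ∀ j, j ≤ K → b j = 0
  right_bound : ∀ j, K < j → 0 ≤ b j ∧ b j < p
  dvd : ∀ j k, p ∣ a K * (b j * b k - if k = j then t j * b j else 0)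

lemma IsAdmissiblePair.isIrreducibleSubringMatrix {q : ℕ} (hq : 1 < q) {α : Fin m → ℕ}
    (hz : ∀ i, z ≤ i) (hzK : z < K) (hα : ∀ i, (q : ℤ) ^ α i = q * t i) (ht : ∀ i, 0 < t i)
    (htz : t z = q) (htK : t K = q) (h : IsAdmissiblePair (q : ℤ) z K t a b) :
    IsIrreducibleSubringMatrix q α (twoRowMatrix (q : ℤ) z K t a b) := by
  have hq' : (0 : ℤ) < q := by exact_mod_cast one_pos.trans hq
  have hbz := h.right_zero z hzK.le
  have hbK := h.right_zero K le_rfl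
  have hdiag : ∀ i : Fin m, twoRowMatrix (q : ℤ) z K t a b i.castSucc i.castSucc = q * t i := by
    intro i
    rw [twoRowMatrix_castSucc_castSucc]
    have h1 : (if i = z then a i else 0) = 0 := by
      split_ifs with h1
      · rw [h1, h.left_z]
      · rfl
    have h2 : (if i = K then b i else 0) = 0 := by
      split_ifs with h2
      · rw [h2, hbK]
      · rfl
    rw [h1, h2, if_pos rfl, add_zero, add_zero]
  refine ⟨⟨?_, ?_, ?_, ?_, ?_⟩, ?_, ?_, ?_, ?_⟩
  · intro i j hji
    induction j using Fin.lastCases with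
    | last => exact absurd hji (Fin.le_last i).not_gt
    | cast j =>
      induction i using Fin.lastCases with
      | last => simp
      | cast i =>
        rw [Fin.castSucc_lt_castSucc_iff] at hji
        have h1 : i ≠ z := fun h1 => (hz j).not_gt (h1 ▸ hji)
        have h2 : (if i = K then b j else 0) = 0 := by
          split_ifs with h2
          · exact h.right_zero j (h2 ▸ hji.le)
          · rfl
        rw [twoRowMatrix_castSucc_castSucc, h2, if_neg h1, if_neg hji.ne']
        simp
  · intro i
    induction i using Fin.lastCases with
    | last => simp
    | cast i => rw [hdiag]; exact mul_pos hq' (ht i)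
  · intro i j hij
    induction i using Fin.lastCases with
    | last => exact absurd hij (Fin.le_last j).not_gt
    | cast i =>
      rw [hdiag]
      have hti := ht i
      induction j using Fin.lastCases with
      | last =>
        rw [twoRowMatrix_last_right]
        have : (q : ℤ) ≤ q * t i := le_mul_of_one_le_right hq'.le hti
        have : (1 : ℤ) < q := by exact_mod_cast hq
        omega
      | cast j =>
        rw [Fin.castSucc_lt_castSucc_iff] at hij
        rw [twoRowMatrix_castSucc_castSucc, if_neg hij.ne, zero_add,
          mul_lt_mul_iff_right₀ hq', mul_nonneg_iff_of_pos_left hq']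
        by_cases h1 : i = z
        · subst h1
          have := h.left_bound j hij.ne'
          simp [hzK.ne, htz, this]
        · by_cases h2 : i = K
          · subst h2
            have := h.right_bound j hij
            simp [h1, htK, this]
          · simp [h1, h2, hti]
  · have := inColSpan_column (twoRowMatrix (q : ℤ) z K t a b) (Fin.last m)
    simpa using this
  · intro j k
    induction j using Fin.lastCases with
    | last =>
      simpa using inColSpan_column (twoRowMatrix (q : ℤ) z K t a b) k
    | cast j =>
      induction k using Fin.lastCases with
      | last => simpa using inColSpan_column (twoRowMatrix (q : ℤ) z K t a b) j.castSucc
      | cast k =>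
        exact (inColSpan_twoRowMatrix_mul_iff hq'.ne' hzK.ne (fun i => (ht i).ne') htz htK
          h.left_z hbz hbK j k).2 (h.dvd j k)
  · intro i; rw [hdiag, hα]
  · simp
  · simp
  · intro i j hij
    simp

lemma IsIrreducibleSubringMatrix.exists_isAdmissiblePair {q : ℕ} (hq : 0 < q) {α : Fin m → ℕ}
    (hz : ∀ i, z ≤ i) (hzK : z < K) {l : Fin m} (hl : ∀ i, i ≤ l)
    (hα : ∀ i, (q : ℤ) ^ α i = q * t i) (ht : ∀ i, 0 < t i)
    (htz : t z = q) (htK : t K = q) (ht1 : ∀ i, i ≠ z → i ≠ K → i ≠ l → t i = 1)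
    {A : Matrix (Fin (m + 1)) (Fin (m + 1)) ℤ} (h : IsIrreducibleSubringMatrix q α A) :
    ∃ a b, IsAdmissiblePair (q : ℤ) z K t a b ∧ A = twoRowMatrix (q : ℤ) z K t a b := by
  obtain ⟨⟨hlow, -, hup, -, hmul⟩, hdiag, hll, hlast, hdvd⟩ := h
  have hq' : (0 : ℤ) < q := by exact_mod_cast hq
  let a : Fin m → ℤ := fun j => if j = z then 0 else A z.castSucc j.castSucc / q
  let b : Fin m → ℤ := fun j => if K < j then A K.castSucc j.castSucc / q else 0
  have ha : ∀ j, z < j → q * a j = A z.castSucc j.castSucc := fun j hj => by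
    simp only [a, hj.ne', if_false]
    exact Int.mul_ediv_cancel' (hdvd z j hj)
  have hb : ∀ j, K < j → q * b j = A K.castSucc j.castSucc := fun j hj => by
    simp only [b, hj, if_true]
    exact Int.mul_ediv_cancel' (hdvd K j hj)
  have haz : a z = 0 := by simp [a]
  have hb0 : ∀ j, j ≤ K → b j = 0 := fun j hj => by simp [b, hj.not_gt]
  have hbound : ∀ i j : Fin m, i < j → ∀ c : ℤ, q * c = A i.castSucc j.castSucc →
      0 ≤ c ∧ c < t i := by
    intro i j hij c hc
    have := hup i.castSucc j.castSucc (Fin.castSucc_lt_castSucc_iff.2 hij)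
    rw [← hc, hdiag, hα, mul_lt_mul_iff_right₀ hq', mul_nonneg_iff_of_pos_left hq'] at this
    exact this
  have hA : A = twoRowMatrix (q : ℤ) z K t a b := by
    ext i j
    induction j using Fin.lastCases with
    | last => simp [hlast]
    | cast j =>
      induction i using Fin.lastCases with
      | last => simpa using hlow _ _ (Fin.castSucc_lt_last j)
      | cast i =>
        rw [twoRowMatrix_castSucc_castSucc]
        rcases lt_trichotomy i j with hij | rfl | hij
        · rw [if_neg hij.ne]
          by_cases h1 : i = z
          · subst h1
            simp [hzK.ne, ha j hij]
          · by_cases h2 : i = K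
            · subst h2
              simp [h1, hb j hij]
            · obtain ⟨c, hc⟩ := hdvd i j hij
              have h3 := hbound i j hij c hc.symm
              rw [ht1 i h1 h2 (hij.trans_le (hl j)).ne] at h3
              have h4 : c = 0 := by omega
              simp [h1, h2, hc, h4]
        · rw [hdiag, hα, if_pos rfl]
          by_cases h1 : i = z
          · subst h1; simp [haz, hb0 i hzK.le]
          · by_cases h2 : i = K
            · subst h2; simp [h1, hb0 i le_rfl]
            · simp [h1, h2]
        · rw [hlow _ _ (Fin.castSucc_lt_castSucc_iff.2 hij), if_neg hij.ne']
          have h1 : i ≠ z := fun h1 => (hz j).not_gt (h1 ▸ hij)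
          by_cases h2 : i = K
          · subst h2; simp [h1, hb0 j hij.le]
          · simp [h1, h2]
  refine ⟨a, b, ⟨haz, fun j hj => ?_, hb0, fun j hj => ?_, fun j k => ?_⟩, hA⟩
  · have hzj : z < j := lt_of_le_of_ne (hz j) hj.symm
    rw [← htz]
    exact hbound z j hzj _ (ha j hzj)
  · rw [← htK]
    exact hbound K j hj _ (hb j hj)
  · rw [← inColSpan_twoRowMatrix_mul_iff hq'.ne' hzK.ne (fun i => (ht i).ne') htz htK haz
      (hb0 z hzK.le) (hb0 K le_rfl) j k, ← hA]
    exact hmul _ _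

lemma eq_of_twoRowMatrix_eq (hp : p ≠ 0) (hzK : z ≠ K) {a' b' : Fin m → ℤ}
    (heq : twoRowMatrix p z K t a b = twoRowMatrix p z K t a' b') : a = a' ∧ b = b' := by
  constructor <;> ext j
  · have := congrFun (congrFun heq z.castSucc) j.castSucc
    simp only [twoRowMatrix_castSucc_castSucc, hzK, if_true, if_false] at this
    linarith [mul_left_cancel₀ hp this]
  · have := congrFun (congrFun heq K.castSucc) j.castSucc
    simp only [twoRowMatrix_castSucc_castSucc, hzK.symm, if_true, if_false] at this
    linarith [mul_left_cancel₀ hp this]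

/-- The integer vectors with entry `0` at `z`, entry in `S` at `K` and entries in `[0, q)`
elsewhere. -/
noncomputable def boxFinset (q : ℕ) (z K : Fin m) (S : Finset ℤ) : Finset (Fin m → ℤ) :=
  Fintype.piFinset fun j => if j = z then {0} else if j = K then S else Finset.Ico 0 (q : ℤ)

lemma mem_boxFinset {q : ℕ} (hzK : z ≠ K) {S : Finset ℤ} :
    a ∈ boxFinset q z K S ↔
      a z = 0 ∧ a K ∈ S ∧ ∀ j, j ≠ z → j ≠ K → 0 ≤ a j ∧ a j < q := by
  rw [boxFinset, Fintype.mem_piFinset]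
  constructor
  · intro h
    refine ⟨by simpa using h z, by simpa [hzK.symm] using h K, fun j h1 h2 => ?_⟩
    simpa [h1, h2] using h j
  · rintro ⟨h1, h2, h3⟩ j
    split_ifs with hz hK
    · simp [hz, h1]
    · simpa [hK] using h2
    · simpa using h3 j hz hK

lemma card_boxFinset {q : ℕ} (hzK : z ≠ K) (S : Finset ℤ) :
    (boxFinset q z K S).card = S.card * q ^ (m - 2) := by
  rw [boxFinset, Fintype.card_piFinset, ← Finset.mul_prod_erase _ _ (Finset.mem_univ z),
    ← Finset.mul_prod_erase _ _ (Finset.mem_erase.2 ⟨hzK.symm, Finset.mem_univ K⟩),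
    Finset.prod_congr rfl (g := fun _ => q)]
  · rw [Finset.prod_const, Finset.card_erase_of_mem
      (Finset.mem_erase.2 ⟨hzK.symm, Finset.mem_univ K⟩),
      Finset.card_erase_of_mem (Finset.mem_univ z), Finset.card_univ, Fintype.card_fin]
    simp [hzK.symm, Nat.sub_sub]
  · intro j hj
    simp only [Finset.mem_erase] at hj
    simp [hj.1, hj.2.1]

/-- The integer vectors supported on indices `> K`, with entries in `[0, q)`. -/
noncomputable def tailFinset (q : ℕ) (K : Fin m) : Finset (Fin m → ℤ) :=
  Fintype.piFinset fun j => if j ≤ K then {0} else Finset.Ico 0 (q : ℤ)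

lemma mem_tailFinset {q : ℕ} : b ∈ tailFinset q K ↔
    (∀ j, j ≤ K → b j = 0) ∧ ∀ j, K < j → 0 ≤ b j ∧ b j < q := by
  rw [tailFinset, Fintype.mem_piFinset, ← forall_and]
  refine forall_congr' fun j => ?_
  rcases le_or_gt j K with h | h
  · simp [h, h.not_gt]
  · simp [h, h.not_ge]

lemma card_tailFinset (q : ℕ) (K : Fin m) : (tailFinset q K).card = q ^ (m - 1 - K) := by
  rw [tailFinset, Fintype.card_piFinset, ← Fin.card_Ioi, ← Finset.prod_const,
    ← Finset.prod_subset (Finset.subset_univ (Finset.Ioi K))]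
  · refine Finset.prod_congr rfl fun j hj => ?_
    simp [(Finset.mem_Ioi.1 hj).not_ge]
  · intro j _ hj
    simp [not_lt.1 fun h => hj (Finset.mem_Ioi.2 h)]

/-- The zero vector and the standard basis vectors indexed strictly between `K` and `l`. -/
def unitFinset (K l : Fin m) : Finset (Fin m → ℤ) :=
  (Finset.Ioi K).image fun i => if i = l then (0 : Fin m → ℤ) else Pi.single i 1

lemma card_unitFinset (K l : Fin m) : (unitFinset K l).card = m - 1 - K := by
  rw [unitFinset, Finset.card_image_of_injective, Fin.card_Ioi]
  intro i j hij
  by_cases hi : i = l <;> by_cases hj : j = l <;> simp only [hi, hj, if_true, if_false] at hij ⊢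
  · simpa using congrFun hij j
  · simpa using congrFun hij i
  · by_contra hne
    simpa [hne] using congrFun hij i

lemma isAdmissiblePair_iff_mem {q : ℕ} (hq : q.Prime) (hzK : z < K) {l : Fin m}
    (hKl : K < l) (htl : (q : ℤ) ∣ t l)
    (ht1 : ∀ i, K < i → i ≠ l → t i = 1) :
    IsAdmissiblePair (q : ℤ) z K t a b ↔
      (a, b) ∈ boxFinset q z K {0} ×ˢ tailFinset q K ∪
        boxFinset q z K (Finset.Ico 1 (q : ℤ)) ×ˢ unitFinset K l := by
  have hq1 : (1 : ℤ) < q := by exact_mod_cast hq.one_lt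
  simp only [Finset.mem_union, Finset.mem_product, mem_boxFinset hzK.ne, mem_tailFinset,
    Finset.mem_singleton, Finset.mem_Ico]
  constructor
  · rintro ⟨h1, h2, h3, h4, h5⟩
    rcases (forall_dvd_iff_mem_image hq hKl htl ht1 (h2 K hzK.ne') h3 h4).1 h5 with h | h
    · exact Or.inl ⟨⟨h1, h, fun j hj _ => h2 j hj⟩, h3, h4⟩
    · by_cases h0 : a K = 0
      · exact Or.inl ⟨⟨h1, h0, fun j hj _ => h2 j hj⟩, h3, h4⟩
      · have := h2 K hzK.ne'
        exact Or.inr ⟨⟨h1, ⟨by omega, this.2⟩, fun j hj _ => h2 j hj⟩, h⟩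
  · rintro (⟨⟨h1, h2, h3⟩, h4, h5⟩ | ⟨⟨h1, h2, h3⟩, h4⟩)
    · refine ⟨h1, fun j hj => ?_, h4, h5, by simp [h2]⟩
      by_cases hjK : j = K
      · subst hjK; omega
      · exact h3 j hj hjK
    · have hb : (∀ j, j ≤ K → b j = 0) ∧ ∀ j, K < j → 0 ≤ b j ∧ b j < q := by
        obtain ⟨i, hi, rfl⟩ := Finset.mem_image.1 h4
        rw [Finset.mem_Ioi] at hi
        split_ifs
        · simp; omega
        · refine ⟨fun j hj => by simp [(hj.trans_lt hi).ne], fun j _ => ?_⟩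
          rw [Pi.single_apply]
          split_ifs <;> omega
      have haK : 0 ≤ a K ∧ a K < q := ⟨by omega, h2.2⟩
      refine ⟨h1, fun j hj => ?_, hb.1, hb.2,
        (forall_dvd_iff_mem_image hq hKl htl ht1 haK hb.1 hb.2).2 (Or.inr h4)⟩
      by_cases hjK : j = K
      · exact hjK ▸ haK
      · exact h3 j hj hjK

lemma gComp_eq_of_two_rows {q : ℕ} (hq : q.Prime) {α : Fin m → ℕ} {l : Fin m}
    (hz : ∀ i, z ≤ i) (hzK : z < K) (hl : ∀ i, i ≤ l) (hKl : K < l)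
    (hα : ∀ i, (q : ℤ) ^ α i = q * t i) (ht : ∀ i, 0 < t i)
    (htz : t z = q) (htK : t K = q) (htl : (q : ℤ) ∣ t l)
    (ht1 : ∀ i, i ≠ z → i ≠ K → i ≠ l → t i = 1) :
    gComp q α = q ^ (m - 2 + (m - 1 - K)) + (m - 1 - K) * (q - 1) * q ^ (m - 2) := by
  have ht1' : ∀ i, K < i → i ≠ l → t i = 1 := fun i hi =>
    ht1 i (hzK.trans hi).ne' hi.ne'
  have hset : {A | IsIrreducibleSubringMatrix q α A} =
      ↑((boxFinset q z K {0} ×ˢ tailFinset q K ∪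
        boxFinset q z K (Finset.Ico 1 (q : ℤ)) ×ˢ unitFinset K l).image
          fun x => twoRowMatrix (q : ℤ) z K t x.1 x.2) := by
    ext A
    rw [Finset.mem_coe, Finset.mem_image]
    constructor
    · intro h
      obtain ⟨a, b, hab, rfl⟩ := h.exists_isAdmissiblePair hq.pos hz hzK hl hα ht htz htK ht1
      exact ⟨(a, b), (isAdmissiblePair_iff_mem hq hzK hKl htl ht1').1 hab, rfl⟩
    · rintro ⟨⟨a, b⟩, hab, rfl⟩
      exact ((isAdmissiblePair_iff_mem hq hzK hKl htl ht1').2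
        hab).isIrreducibleSubringMatrix hq.one_lt hz hzK hα ht htz htK
  have hinj : Function.Injective fun x : (Fin m → ℤ) × (Fin m → ℤ) =>
      twoRowMatrix (q : ℤ) z K t x.1 x.2 := fun x y hxy =>
    Prod.ext_iff.2 (eq_of_twoRowMatrix_eq (by exact_mod_cast hq.ne_zero) hzK.ne hxy)
  have hdisj : Disjoint (boxFinset q z K {0} ×ˢ tailFinset q K)
      (boxFinset q z K (Finset.Ico 1 (q : ℤ)) ×ˢ unitFinset K l) := by
    rw [Finset.disjoint_left]
    rintro ⟨a, b⟩ h1 h2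
    simp only [Finset.mem_product, mem_boxFinset hzK.ne, Finset.mem_singleton,
      Finset.mem_Ico] at h1 h2
    omega
  calc gComp q α = {A | IsIrreducibleSubringMatrix q α A}.ncard := rfl
    _ = _ := by
      rw [hset, Set.ncard_coe_finset, Finset.card_image_of_injective _ hinj,
        Finset.card_union_of_disjoint hdisj, Finset.card_product, Finset.card_product,
        card_boxFinset hzK.ne, card_boxFinset hzK.ne, card_tailFinset, card_unitFinset,
        Finset.card_singleton, Int.card_Ico]
      have : ((q : ℤ) - 1).toNat = q - 1 := by omega
      rw [this]
      ring

end twoRowMatrix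

theorem g_two_ones_two_ones_beta (p : ℕ) (hp : p.Prime) (n : ℕ) (hn : 4 ≤ n)
    (k : ℕ) (hk1 : 2 ≤ k) (hk2 : k ≤ n - 2) (β : ℕ) (hβ : 2 ≤ β) :
    gComp p (fun i : Fin (n - 1) =>
        if i.val = 0 then 2 else if i.val = k - 1 then 2 else
          if i.val = n - 2 then β else 1) =
      p ^ (n - 3 + (n - 1 - k)) + (n - 1 - k) * (p - 1) * p ^ (n - 3) := by
  obtain ⟨m, rfl⟩ : ∃ m, n = m + 1 := ⟨n - 1, by omega⟩
  have hmk : m + 1 - 1 - k = m - 1 - (k - 1) := by omega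
  have h3 : m + 1 - 3 = m - 2 := by omega
  rw [hmk, h3]
  refine gComp_eq_of_two_rows (z := (⟨0, by omega⟩ : Fin m)) (K := ⟨k - 1, by omega⟩)
    (l := ⟨m - 1, by omega⟩)
    (t := fun i => if i.val = 0 then (p : ℤ) else if i.val = k - 1 then (p : ℤ) else
      if i.val = m - 1 then (p : ℤ) ^ (β - 1) else 1)
    hp (fun i => ?_) ?_ (fun i => ?_) ?_ (fun i => ?_) (fun i => ?_) ?_ ?_ ?_ ?_
  · simp [Fin.le_def]
  · simp only [Fin.lt_def]; omega
  · simp only [Fin.le_def]; omega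
  · simp only [Fin.lt_def]; omega
  · have hm : m + 1 - 2 = m - 1 := by omega
    simp only [hm]
    split_ifs
    · ring
    · ring
    · rw [← pow_succ']; congr 1; omega
    · ring
  · have : (0 : ℤ) < p := by exact_mod_cast hp.pos
    split_ifs <;> positivity
  · simp
  · simp
  · have h0 : m - 1 ≠ 0 := by omega
    have h1 : m - 1 ≠ k - 1 := by omega
    simp only [h0, h1, if_false, if_true]
    exact dvd_pow_self _ (by omega)
  · intro i h0 h1 h2
    simp only [ne_eq, Fin.ext_iff] at h0 h1 h2
    simp [h0, h1, h2]
end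

section
/- Let p be a prime, n ≥ 5 an integer, k an integer with 2 ≤ k ≤ n−3, β ≥ 2 an integer, and set r = n−1−k. Let α be the composition of length n−1 with α_1 = 2, α_k = 2, α_{n−2} = β, α_{n−1} = 1, and α_i = 1 for all other indices i. If β = 2, then g_α(p) = 2p^{n−3+r} + p^{n−5+r}(p−2) + 2r·p^{n−3}(p−1) + p^{n−4}(p−1)(p−2)(p+r−2). If β ≥ 3, then g_α(p) = 2p^{n−3+r} + 2p^{n−5+r}(p−1) + 2r·p^{n−3}(p−1) + 2p^{n−4}(p−1)^2(p+r−2). -/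
/-- The `j`-th column of a matrix with diagonal `d` whose off-diagonal entries lie in the rows
`o`, `K` and `q`; the only one of them in row `q` stands in column `l`. -/
def sparseCol {ι : Type*} [DecidableEq ι] (o K q l : ι) (p : ℤ) (d a b : ι → ℤ) (c : ℤ)
    (j i : ι) : ℤ :=
  (if i = j then d j else 0) + (if i = o then p * a j else 0) + (if i = K then p * b j else 0) +
    (if i = q ∧ j = l then p * c else 0)

/-- The diagonal and the off-diagonal entries of the columns `sparseCol` are those of an
irreducible subring matrix with exponents `2`, `2`, `β` at `o`, `K`, `q` and `1` elsewhere. -/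
structure IsSparseFrame {ι : Type*} (o K q l : ι) (p : ℤ) (β : ℕ) (d a b : ι → ℤ) : Prop where
  oK : o ≠ K
  oq : o ≠ q
  ol : o ≠ l
  Kq : K ≠ q
  Kl : K ≠ l
  ql : q ≠ l
  hp : p ≠ 0
  hβ : 2 ≤ β
  d_o : d o = p ^ 2
  d_K : d K = p ^ 2
  d_q : d q = p ^ β
  d_other : ∀ i, i ≠ o → i ≠ K → i ≠ q → d i = p
  a_o : a o = 0
  b_o : b o = 0
  b_K : b K = 0

/-- The conditions on the entries under which the columns `sparseCol` span a ring. -/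
structure SparseClosed {ι : Type*} (o K q l : ι) (p : ℤ) (β : ℕ) (a b : ι → ℤ) (c : ℤ) :
    Prop where
  mul_ne : ∀ i j, i ≠ j → i ≠ o → i ≠ K → i ≠ q → i ≠ l → j ≠ o → j ≠ K → j ≠ q → j ≠ l →
    p ∣ a K * (b i * b j)
  sq : ∀ i, i ≠ o → i ≠ K → i ≠ q → i ≠ l → p ∣ a K * (b i ^ 2 - b i)
  mul_q : ∀ i, i ≠ o → i ≠ K → i ≠ q → i ≠ l → p ∣ a K * (b i * b q)
  mul_l : ∀ i, i ≠ o → i ≠ K → i ≠ q → i ≠ l → p ∣ a K * (b i * b l)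
  sq_q : p ∣ a K * b q ^ 2
  q_l : p ∣ a K * (b q * b l - c * b q)
  sq_l : ∃ t s, c ^ 2 - c = p ^ (β - 2) * t ∧ p * (b l ^ 2 - b l) = p * s + b q * t ∧
    p ∣ a K * s + a q * t

namespace IsSparseFrame

variable {ι : Type*} [DecidableEq ι] {o K q l : ι} {p : ℤ} {β : ℕ} {d a b : ι → ℤ}
  {c : ℤ}

theorem mul_col_o_mem (h : IsSparseFrame o K q l p β d a b) (j : ι) :
    sparseCol o K q l p d a b c o * sparseCol o K q l p d a b c j ∈
        Submodule.span ℤ (Set.range (sparseCol o K q l p d a b c)) := by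
  have : sparseCol o K q l p d a b c o * sparseCol o K q l p d a b c j =
      sparseCol o K q l p d a b c j o • sparseCol o K q l p d a b c o := by
    funext i
    by_cases hi : i = o
    · subst hi; simp [mul_comm]
    · simp [sparseCol, hi, h.b_o, h.ol]
  rw [this]
  exact Submodule.smul_mem _ _ (Submodule.subset_span ⟨o, rfl⟩)

theorem dvd_col (h : IsSparseFrame o K q l p β d a b) (i j : ι) :
    p ∣ sparseCol o K q l p d a b c j i := by
  have hd : p ∣ d j := by
    by_cases h1 : j = o
    · rw [h1, h.d_o]; exact dvd_pow_self _ two_ne_zero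
    by_cases h2 : j = K
    · rw [h2, h.d_K]; exact dvd_pow_self _ two_ne_zero
    by_cases h3 : j = q
    · rw [h3, h.d_q]; exact dvd_pow_self _ (by have := h.hβ; omega)
    rw [h.d_other j h1 h2 h3]
  unfold sparseCol
  refine dvd_add (dvd_add (dvd_add ?_ ?_) ?_) ?_ <;> split_ifs <;> simp [hd]

variable [Fintype ι]

theorem mem_span_iff (h : IsSparseFrame o K q l p β d a b) (w₀ w₁ w₂ : ℤ) :
    (fun i => if i = o then w₀ else if i = K then w₁ else if i = q then w₂ else 0) ∈
        Submodule.span ℤ (Set.range (sparseCol o K q l p d a b c)) ↔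
      ∃ t s u, w₂ = p ^ β * t ∧ w₁ = p ^ 2 * s + p * b q * t ∧
        w₀ = p ^ 2 * u + p * a K * s + p * a q * t := by
  have := h.oK; have := h.oq; have := h.ol; have := h.Kq; have := h.Kl; have := h.ql
  have hp := h.hp
  rw [Submodule.mem_span_range_iff_exists_fun]
  constructor
  · rintro ⟨x, hx⟩
    have eval : ∀ i, x i * d i + (if i = o then p * ∑ j, x j * a j else 0) +
        (if i = K then p * ∑ j, x j * b j else 0) + (if i = q then x l * (p * c) else 0) =
        if i = o then w₀ else if i = K then w₁ else if i = q then w₂ else 0 := by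
      intro i
      rw [← congrFun hx i]
      simp only [Finset.sum_apply, Pi.smul_apply, smul_eq_mul, sparseCol, mul_add,
        Finset.sum_add_distrib]
      congr 1
      · congr 1
        · congr 1
          · simp
          · split_ifs
            · rw [Finset.mul_sum]; exact Finset.sum_congr rfl fun j _ => by ring
            · simp
        · split_ifs
          · rw [Finset.mul_sum]; exact Finset.sum_congr rfl fun j _ => by ring
          · simp
      · by_cases hi : i = q <;> simp [hi]
    have zero : ∀ i, i ≠ o → i ≠ K → i ≠ q → x i = 0 := by
      intro i h1 h2 h3
      have := eval i
      simpa [h1, h2, h3, h.d_other i h1 h2 h3, hp] using this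
    have red : ∀ f : ι → ℤ, f o = 0 → ∑ j, x j * f j = x K * f K + x q * f q := by
      intro f hf
      apply Finset.sum_eq_add K q h.Kq
      · rintro j - ⟨h1, h2⟩
        by_cases h3 : j = o
        · simp [h3, hf]
        · simp [zero j h3 h1 h2]
      · simp
      · simp
    have e₀ := eval o
    have e₁ := eval K
    have e₂ := eval q
    simp only [red a h.a_o, red b h.b_o, h.d_o, h.d_K, h.d_q, h.oK, h.oq, h.Kq, h.oK.symm,
      h.oq.symm, h.Kq.symm, if_true, if_false, zero l h.ol.symm h.Kl.symm h.ql.symm,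
      h.b_K] at e₀ e₁ e₂
    exact ⟨x q, x K, x o, by linarith, by linarith, by linarith⟩
  · rintro ⟨t, s, u, h2, h1, h0⟩
    refine ⟨fun j => if j = o then u else if j = K then s else if j = q then t else 0, ?_⟩
    have split : ∀ j, (if j = o then u else if j = K then s else if j = q then t else 0) =
        (if j = o then u else 0) + (if j = K then s else 0) + (if j = q then t else 0) := by
      intro j
      split_ifs <;> simp_all
    funext i
    simp only [Finset.sum_apply, Pi.smul_apply, smul_eq_mul, split, add_mul, ite_mul, zero_mul,
      Finset.sum_add_distrib, Finset.sum_ite_eq', Finset.mem_univ, if_true]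
    simp only [sparseCol, h.d_o, h.d_K, h.d_q, h.a_o, h.b_o, h.b_K, h.ol, h.Kl, h.ql]
    by_cases i0 : i = o
    · subst i0; simp [*]; ring
    by_cases i1 : i = K
    · subst i1; simp [*, h.oK.symm]; ring
    by_cases i2 : i = q
    · subst i2; simp [*]; ring
    simp [*]

theorem mem_span_iff_dvd (h : IsSparseFrame o K q l p β d a b) (x y : ℤ) :
    (fun i => if i = o then p ^ 2 * x else if i = K then p ^ 2 * y else if i = q then 0 else 0) ∈
        Submodule.span ℤ (Set.range (sparseCol o K q l p d a b c)) ↔ p ∣ a K * y := by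
  have hp := h.hp
  rw [h.mem_span_iff]
  constructor
  · rintro ⟨t, s, u, h2, h1, h0⟩
    have ht : t = 0 := by simpa [hp] using h2
    subst ht
    have hs : y = s := by
      apply mul_left_cancel₀ (pow_ne_zero 2 hp); linarith
    subst hs
    refine ⟨x - u, ?_⟩
    apply mul_left_cancel₀ hp; linarith
  · rintro ⟨z, hz⟩
    exact ⟨0, y, x - z, by simp, by ring, by linear_combination - p * hz⟩

theorem mul_mem_span_iff_dvd (h : IsSparseFrame o K q l p β d a b) {i j m : ι} (z x y : ℤ)
    (hr : ∀ i', sparseCol o K q l p d a b c i i' * sparseCol o K q l p d a b c j i' =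
      z * sparseCol o K q l p d a b c m i' +
        if i' = o then p ^ 2 * x else if i' = K then p ^ 2 * y else if i' = q then 0 else 0) :
    sparseCol o K q l p d a b c i * sparseCol o K q l p d a b c j ∈
        Submodule.span ℤ (Set.range (sparseCol o K q l p d a b c)) ↔ p ∣ a K * y := by
  rw [← h.mem_span_iff_dvd (c := c) (l := l) x y]
  have : sparseCol o K q l p d a b c i * sparseCol o K q l p d a b c j =
      z • sparseCol o K q l p d a b c m + fun i =>
        if i = o then p ^ 2 * x else if i = K then p ^ 2 * y else if i = q then 0 else 0 := by
    funext i'; simpa using hr i'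
  rw [this]
  exact Submodule.add_mem_iff_right _
    (Submodule.smul_mem _ _ (Submodule.subset_span ⟨m, rfl⟩))

theorem sq_l_mem_span_iff (h : IsSparseFrame o K q l p β d a b) :
    sparseCol o K q l p d a b c l * sparseCol o K q l p d a b c l ∈
        Submodule.span ℤ (Set.range (sparseCol o K q l p d a b c)) ↔
      ∃ t s, c ^ 2 - c = p ^ (β - 2) * t ∧ p * (b l ^ 2 - b l) = p * s + b q * t ∧
        p ∣ a K * s + a q * t := by
  have hp := h.hp
  have hβ : p ^ β = p ^ 2 * p ^ (β - 2) := by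
    rw [← pow_add, Nat.add_sub_cancel' h.hβ]
  have : sparseCol o K q l p d a b c l * sparseCol o K q l p d a b c l =
      p • sparseCol o K q l p d a b c l + fun i =>
        if i = o then p ^ 2 * (a l ^ 2 - a l) else if i = K then p ^ 2 * (b l ^ 2 - b l) else
          if i = q then p ^ 2 * (c ^ 2 - c) else 0 := by
    funext i
    have := h.oK; have := h.oq; have := h.ol; have := h.Kq; have := h.Kl; have := h.ql
    simp only [Pi.mul_apply, Pi.add_apply, Pi.smul_apply, smul_eq_mul, sparseCol]
    rw [h.d_other l h.ol.symm h.Kl.symm h.ql.symm]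
    by_cases i0 : i = o
    · subst i0; simp [*]; ring
    by_cases i1 : i = K
    · subst i1; simp [*]; ring
    by_cases i2 : i = q
    · subst i2; simp [*]; ring
    simp [*]
  rw [this, Submodule.add_mem_iff_right _
    (Submodule.smul_mem _ p (Submodule.subset_span (Set.mem_range_self l))), h.mem_span_iff]
  constructor
  · rintro ⟨t, s, u, h2, h1, h0⟩
    refine ⟨t, s, ?_, ?_, a l ^ 2 - a l - u, ?_⟩
    · apply mul_left_cancel₀ (pow_ne_zero 2 hp); rw [h2, hβ]; ring
    · apply mul_left_cancel₀ hp; linarith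
    · apply mul_left_cancel₀ hp; linarith
  · rintro ⟨t, s, h2, h1, z, hz⟩
    refine ⟨t, s, a l ^ 2 - a l - z, ?_, ?_, ?_⟩
    · rw [h2, hβ]; ring
    · linear_combination p * h1
    · linear_combination -p * hz

theorem mul_col_K_mem (h : IsSparseFrame o K q l p β d a b) (j : ι) :
    sparseCol o K q l p d a b c K * sparseCol o K q l p d a b c j ∈
        Submodule.span ℤ (Set.range (sparseCol o K q l p d a b c)) := by
  obtain ⟨x, hx⟩ := h.dvd_col (c := c) o j
  obtain ⟨y, hy⟩ := h.dvd_col (c := c) K j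
  rw [h.mul_mem_span_iff_dvd (m := K) (p * y) (a K * (x - y)) 0]
  · simp
  intro i
  by_cases hi : i = K
  · subst hi; rw [hy]; simp [h.oK.symm, mul_comm]
  by_cases hi : i = o
  · subst hi; rw [hx]; simp [sparseCol, h.oK, h.Kl]; ring
  simp [sparseCol, *, h.Kl]

theorem mul_mem_span_iff (h : IsSparseFrame o K q l p β d a b) :
    (∀ i j, sparseCol o K q l p d a b c i * sparseCol o K q l p d a b c j ∈
        Submodule.span ℤ (Set.range (sparseCol o K q l p d a b c))) ↔
      SparseClosed o K q l p β a b c := by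
  have := h.oK; have := h.oq; have := h.ol; have := h.Kq; have := h.Kl; have := h.ql
  have hp := h.hp
  have hd := h.d_other
  have dq := h.d_q
  have dl := hd l h.ol.symm h.Kl.symm h.ql.symm
  obtain ⟨γ, rfl⟩ : ∃ γ, β = γ + 2 := ⟨β - 2, by have := h.hβ; omega⟩
  have mul_ne : ∀ i j, i ≠ j → i ≠ o → i ≠ K → i ≠ q → i ≠ l → j ≠ o → j ≠ K →
      (sparseCol o K q l p d a b c i * sparseCol o K q l p d a b c j ∈
        Submodule.span ℤ (Set.range (sparseCol o K q l p d a b c)) ↔ p ∣ a K * (b i * b j)) := by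
    intro i j hij i0 i1 i2 i3 j0 j1
    refine h.mul_mem_span_iff_dvd (m := o) 0 (a i * a j) _ fun x => ?_
    simp only [sparseCol]
    by_cases x0 : x = o
    · subst x0; simp [*, i0.symm, j0.symm]; ring
    by_cases x1 : x = K
    · subst x1; simp [*, i1.symm, j1.symm]; ring
    by_cases x2 : x = q
    · subst x2; simp [*, i2.symm]
    have hx : ¬(x = i ∧ x = j) := fun hx => hij (hx.1.symm.trans hx.2)
    by_cases x3 : x = i <;> simp_all
  have sq : ∀ i, i ≠ o → i ≠ K → i ≠ q → i ≠ l →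
      (sparseCol o K q l p d a b c i * sparseCol o K q l p d a b c i ∈
        Submodule.span ℤ (Set.range (sparseCol o K q l p d a b c)) ↔
          p ∣ a K * (b i ^ 2 - b i)) := by
    intro i i0 i1 i2 i3
    refine h.mul_mem_span_iff_dvd (m := i) p (a i ^ 2 - a i) _ fun x => ?_
    simp only [sparseCol]
    by_cases x0 : x = o
    · subst x0; simp [*, i0.symm]; ring
    by_cases x1 : x = K
    · subst x1; simp [*, i1.symm]; ring
    by_cases x2 : x = q
    · subst x2; simp [*, i2.symm]
    by_cases x3 : x = i
    · subst x3; simp [*]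
    simp [*]
  have sq_q : sparseCol o K q l p d a b c q * sparseCol o K q l p d a b c q ∈
        Submodule.span ℤ (Set.range (sparseCol o K q l p d a b c)) ↔ p ∣ a K * b q ^ 2 := by
    rw [h.mul_mem_span_iff_dvd (m := q) (p ^ (γ + 2)) (a q ^ 2 - p ^ (γ + 1) * a q)
      (b q ^ 2 - p ^ (γ + 1) * b q), mul_sub]
    · apply dvd_sub_left
      exact ⟨a K * p ^ γ * b q, by ring⟩
    intro x
    simp only [sparseCol]
    by_cases x0 : x = o
    · subst x0; simp [*]; ring
    by_cases x1 : x = K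
    · subst x1; simp [*]; ring
    by_cases x2 : x = q
    · subst x2; simp [*]
    simp [*]
  have q_l : sparseCol o K q l p d a b c q * sparseCol o K q l p d a b c l ∈
        Submodule.span ℤ (Set.range (sparseCol o K q l p d a b c)) ↔
          p ∣ a K * (b q * b l - c * b q) := by
    refine h.mul_mem_span_iff_dvd (m := q) (p * c) (a q * a l - c * a q) _ fun x => ?_
    simp only [sparseCol]
    by_cases x0 : x = o
    · subst x0; simp [*]; ring
    by_cases x1 : x = K
    · subst x1; simp [*]; ring
    by_cases x2 : x = q
    · subst x2; simp [*]; ring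
    simp [*]
  constructor
  · intro H
    exact
      { mul_ne := fun i j hij i0 i1 i2 i3 j0 j1 _ _ =>
          (mul_ne i j hij i0 i1 i2 i3 j0 j1).1 (H i j)
        sq := fun i i0 i1 i2 i3 => (sq i i0 i1 i2 i3).1 (H i i)
        mul_q := fun i i0 i1 i2 i3 =>
          (mul_ne i q i2 i0 i1 i2 i3 h.oq.symm h.Kq.symm).1 (H i q)
        mul_l := fun i i0 i1 i2 i3 =>
          (mul_ne i l i3 i0 i1 i2 i3 h.ol.symm h.Kl.symm).1 (H i l)
        sq_q := sq_q.1 (H q q)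
        q_l := q_l.1 (H q l)
        sq_l := h.sq_l_mem_span_iff.1 (H l l) }
  · intro H
    have main : ∀ i j, i ≠ o → i ≠ K → i ≠ q → i ≠ l →
        sparseCol o K q l p d a b c i * sparseCol o K q l p d a b c j ∈
        Submodule.span ℤ (Set.range (sparseCol o K q l p d a b c)) := by
      intro i j i0 i1 i2 i3
      by_cases j0 : j = o
      · rw [j0, mul_comm]; exact h.mul_col_o_mem i
      by_cases j1 : j = K
      · rw [j1, mul_comm]; exact h.mul_col_K_mem i
      by_cases hij : i = j
      · rw [← hij]; exact (sq i i0 i1 i2 i3).2 (H.sq i i0 i1 i2 i3)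
      rw [mul_ne i j hij i0 i1 i2 i3 j0 j1]
      by_cases j2 : j = q
      · rw [j2]; exact H.mul_q i i0 i1 i2 i3
      by_cases j3 : j = l
      · rw [j3]; exact H.mul_l i i0 i1 i2 i3
      exact H.mul_ne i j hij i0 i1 i2 i3 j0 j1 j2 j3
    intro i j
    by_cases i0 : i = o
    · rw [i0]; exact h.mul_col_o_mem j
    by_cases i1 : i = K
    · rw [i1]; exact h.mul_col_K_mem j
    by_cases j0 : j = o
    · rw [j0, mul_comm]; exact h.mul_col_o_mem i
    by_cases j1 : j = K
    · rw [j1, mul_comm]; exact h.mul_col_K_mem i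
    by_cases ih : i ≠ q ∧ i ≠ l
    · exact main i j i0 i1 ih.1 ih.2
    by_cases jh : j ≠ q ∧ j ≠ l
    · rw [mul_comm]; exact main j i j0 j1 jh.1 jh.2
    have ih' : i = q ∨ i = l := by tauto
    have jh' : j = q ∨ j = l := by tauto
    rcases ih' with rfl | rfl <;> rcases jh' with rfl | rfl
    · exact sq_q.2 H.sq_q
    · exact q_l.2 H.q_l
    · rw [mul_comm]; exact q_l.2 H.q_l
    · exact h.sq_l_mem_span_iff.2 H.sq_l

end IsSparseFrame

/-- The square matrix whose columns are those of `v`, extended by `0` in the last row, followed by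
a column of ones. -/
def borderedMatrix {m : ℕ} (v : Fin m → Fin m → ℤ) : Matrix (Fin (m + 1)) (Fin (m + 1)) ℤ :=
  fun i j => Fin.lastCases (motive := fun _ => ℤ) 1
    (fun j' => Fin.lastCases (motive := fun _ => ℤ) 0 (fun i' => v j' i') i) j

namespace borderedMatrix

variable {m : ℕ} (v : Fin m → Fin m → ℤ)

@[simp]
theorem apply_last (i : Fin (m + 1)) : borderedMatrix v i (Fin.last m) = 1 := by
  simp [borderedMatrix]

@[simp]
theorem last_castSucc (j : Fin m) : borderedMatrix v (Fin.last m) j.castSucc = 0 := by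
  simp [borderedMatrix]

@[simp]
theorem castSucc_castSucc (i j : Fin m) : borderedMatrix v i.castSucc j.castSucc = v j i := by
  simp [borderedMatrix]

theorem inColSpan_col (j : Fin (m + 1)) :
    InColSpan (borderedMatrix v) fun i => borderedMatrix v i j :=
  ⟨Pi.single j 1, by ext i; simp⟩

theorem inColSpan_mul_iff (j k : Fin m) :
    InColSpan (borderedMatrix v)
        (fun i => borderedMatrix v i j.castSucc * borderedMatrix v i k.castSucc) ↔
      v j * v k ∈ Submodule.span ℤ (Set.range v) := by
  rw [Submodule.mem_span_range_iff_exists_fun]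
  constructor
  · rintro ⟨x, hx⟩
    have h0 : x (Fin.last m) = 0 := by
      have := congrFun hx (Fin.last m)
      simpa [Matrix.mulVec, dotProduct, Fin.sum_univ_castSucc] using this
    refine ⟨fun i => x i.castSucc, ?_⟩
    funext i
    have := congrFun hx i.castSucc
    simp only [Matrix.mulVec, dotProduct, Fin.sum_univ_castSucc, castSucc_castSucc, h0,
      mul_zero, add_zero] at this
    simp [← this, mul_comm]
  · rintro ⟨x, hx⟩
    refine ⟨Fin.lastCases (motive := fun _ => ℤ) 0 x, ?_⟩
    funext i
    induction i using Fin.lastCases with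
    | last => simp [Matrix.mulVec, dotProduct, Fin.sum_univ_castSucc]
    | cast i =>
      have := congrFun hx i
      simp only [Finset.sum_apply, Pi.smul_apply, smul_eq_mul, Pi.mul_apply] at this
      simp [Matrix.mulVec, dotProduct, Fin.sum_univ_castSucc, ← this, mul_comm]

end borderedMatrix

theorem isIrreducibleSubringMatrix_iff_exists {p : ℕ} (hp : 1 < p) {m : ℕ} {α : Fin m → ℕ}
    (hα : ∀ i, α i ≠ 0) {A : Matrix (Fin (m + 1)) (Fin (m + 1)) ℤ} :
    IsIrreducibleSubringMatrix p α A ↔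
      ∃ v : Fin m → Fin m → ℤ, borderedMatrix v = A ∧ (∀ i j, j < i → v j i = 0) ∧
        (∀ i, v i i = (p : ℤ) ^ α i) ∧
        (∀ i j, i < j → 0 ≤ v j i ∧ v j i < (p : ℤ) ^ α i ∧ (p : ℤ) ∣ v j i) ∧
        ∀ i j, v i * v j ∈ Submodule.span ℤ (Set.range v) := by
  constructor
  · rintro ⟨⟨h1, -, h3, -, h5⟩, h6, h7, h8, h9⟩
    have hA : borderedMatrix (fun j i => A i.castSucc j.castSucc) = A := by
      ext i j
      induction j using Fin.lastCases with
      | last => simp [h8]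
      | cast j =>
        induction i using Fin.lastCases with
        | last => simp [h1 _ _ (Fin.castSucc_lt_last j)]
        | cast i => simp
    refine ⟨_, hA, fun i j h => h1 _ _ h, h6, fun i j h => ?_, fun i j => ?_⟩
    · have := h3 i.castSucc j.castSucc h
      rw [h6] at this
      exact ⟨this.1, this.2, h9 i j h⟩
    · rw [← borderedMatrix.inColSpan_mul_iff, hA]
      exact h5 _ _
  · rintro ⟨v, rfl, h1, h2, h3, h4⟩
    have one_lt : ∀ i, (1 : ℤ) < (p : ℤ) ^ α i := fun i =>
      one_lt_pow₀ (by exact_mod_cast hp) (hα i)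
    refine ⟨⟨?_, ?_, ?_, ?_, ?_⟩, ?_, ?_, ?_, ?_⟩
    · intro i j hij
      induction j using Fin.lastCases with
      | last => exact absurd hij (Fin.le_last i).not_gt
      | cast j =>
        induction i using Fin.lastCases with
        | last => simp
        | cast i => simpa using h1 i j hij
    · intro i
      induction i using Fin.lastCases with
      | last => simp
      | cast i => simpa [h2] using zero_lt_one.trans (one_lt i)
    · intro i j hij
      induction i using Fin.lastCases with
      | last => exact absurd hij (Fin.le_last j).not_gt
      | cast i =>
        induction j using Fin.lastCases with
        | last => simpa [h2] using one_lt i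
        | cast j =>
          obtain ⟨ha, hb, -⟩ := h3 i j hij
          simpa [h2] using And.intro ha hb
    · simpa using borderedMatrix.inColSpan_col v (Fin.last m)
    · intro j k
      induction j using Fin.lastCases with
      | last => simpa using borderedMatrix.inColSpan_col v k
      | cast j =>
        induction k using Fin.lastCases with
        | last => simpa using borderedMatrix.inColSpan_col v j.castSucc
        | cast k => exact (borderedMatrix.inColSpan_mul_iff v j k).2 (h4 j k)
    · intro i; simp [h2]
    · simp
    · simp
    · intro i j hij; simpa using (h3 i j hij).2.2

/-- The exponents `α` are `2`, `2`, `β` at the first, an intermediate and the last but one index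
and `1` elsewhere. -/
structure IsSparseExponents {m : ℕ} (o K q l : Fin m) (β : ℕ) (α : Fin m → ℕ) : Prop where
  o_val : o.val = 0
  o_lt_K : o < K
  K_lt_q : K < q
  q_val : q.val + 1 = l.val
  l_val : l.val + 1 = m
  hβ : 2 ≤ β
  α_o : α o = 2
  α_K : α K = 2
  α_q : α q = β
  α_other : ∀ i, i ≠ o → i ≠ K → i ≠ q → α i = 1

namespace IsSparseExponents

variable {m : ℕ} {o K q l : Fin m} {β : ℕ} {α : Fin m → ℕ} {p : ℕ}

theorem q_lt_l (h : IsSparseExponents o K q l β α) : q < l :=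
  Fin.lt_def.2 (by have := h.q_val; omega)

theorem o_le (h : IsSparseExponents o K q l β α) (i : Fin m) : o ≤ i :=
  Fin.le_def.2 (by have := h.o_val; omega)

theorem eq_l (h : IsSparseExponents o K q l β α) {i : Fin m} (hi : q < i) : i = l := by
  have := h.q_val; have := h.l_val; ext; rw [Fin.lt_def] at hi; omega

theorem ne_zero (h : IsSparseExponents o K q l β α) (i : Fin m) : α i ≠ 0 := by
  by_cases h1 : i = o
  · rw [h1, h.α_o]; decide
  by_cases h2 : i = K
  · rw [h2, h.α_K]; decide
  by_cases h3 : i = q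
  · rw [h3, h.α_q]; have := h.hβ; omega
  rw [h.α_other i h1 h2 h3]; decide

theorem isSparseFrame (h : IsSparseExponents o K q l β α) (hp : p ≠ 0) {a b : Fin m → ℤ}
    (ha : a o = 0) (hb : ∀ j ≤ K, b j = 0) :
    IsSparseFrame o K q l (p : ℤ) β (fun i => (p : ℤ) ^ α i) a b where
  oK := h.o_lt_K.ne
  oq := (h.o_lt_K.trans h.K_lt_q).ne
  ol := ((h.o_lt_K.trans h.K_lt_q).trans h.q_lt_l).ne
  Kq := h.K_lt_q.ne
  Kl := (h.K_lt_q.trans h.q_lt_l).ne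
  ql := h.q_lt_l.ne
  hp := by exact_mod_cast hp
  hβ := h.hβ
  d_o := by simp [h.α_o]
  d_K := by simp [h.α_K]
  d_q := by simp [h.α_q]
  d_other i h1 h2 h3 := by simp [h.α_other i h1 h2 h3]
  a_o := ha
  b_o := hb o h.o_lt_K.le
  b_K := hb K le_rfl

theorem sparseCol_lower (h : IsSparseExponents o K q l β α) {d a b : Fin m → ℤ} {c : ℤ}
    (hb : ∀ j ≤ K, b j = 0) {i j : Fin m} (hij : j < i) :
    sparseCol o K q l p d a b c j i = 0 := by
  have h0 : i ≠ o := ((h.o_le j).trans_lt hij).ne'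
  have h1 : i = K → b j = 0 := fun hi => hb j (hi ▸ hij.le)
  have h2 : ¬(i = q ∧ j = l) := by
    rintro ⟨rfl, rfl⟩; exact absurd h.q_lt_l hij.not_gt
  simp [sparseCol, hij.ne', h0, h2]
  exact fun hi => .inr (h1 hi)

theorem sparseCol_diag (h : IsSparseExponents o K q l β α) {d a b : Fin m → ℤ} {c : ℤ}
    (ha : a o = 0) (hb : ∀ j ≤ K, b j = 0) (i : Fin m) :
    sparseCol o K q l p d a b c i i = d i := by
  have h0 : i = o → a i = 0 := fun hi => hi ▸ ha
  have h1 : i = K → b i = 0 := fun hi => hb i hi.le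
  have h2 : ¬(i = q ∧ i = l) := fun hi => h.q_lt_l.ne (hi.1.symm.trans hi.2)
  simp only [sparseCol, if_true, if_neg h2]
  split_ifs <;> simp_all

theorem sparseCol_o (h : IsSparseExponents o K q l β α) {d a b : Fin m → ℤ} {c : ℤ}
    {j : Fin m} (hj : o < j) : sparseCol o K q l p d a b c j o = p * a j := by
  simp [sparseCol, hj.ne, h.o_lt_K.ne, (h.o_lt_K.trans h.K_lt_q).ne]

theorem sparseCol_K (h : IsSparseExponents o K q l β α) {d a b : Fin m → ℤ} {c : ℤ}
    {j : Fin m} (hj : K < j) : sparseCol o K q l p d a b c j K = p * b j := by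
  simp [sparseCol, hj.ne, h.o_lt_K.ne', h.K_lt_q.ne]

theorem sparseCol_q (h : IsSparseExponents o K q l β α) {d a b : Fin m → ℤ} {c : ℤ} :
    sparseCol o K q l p d a b c l q = p * c := by
  simp [sparseCol, h.q_lt_l.ne, (h.o_lt_K.trans h.K_lt_q).ne', h.K_lt_q.ne']

theorem sparseCol_other {d a b : Fin m → ℤ} {c : ℤ}
    {i j : Fin m} (hij : i ≠ j) (h0 : i ≠ o) (h1 : i ≠ K) (h2 : i ≠ q) :
    sparseCol o K q l p d a b c j i = 0 := by
  simp [sparseCol, *]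

end IsSparseExponents

/-- The parameters of the irreducible subring matrices with exponents as in
`IsSparseExponents`. -/
def sparseParams {m : ℕ} (o K q l : Fin m) (p β : ℕ) :
    Set ((Fin m → ZMod p) × (Fin m → ZMod p) × Fin (p ^ (β - 1))) :=
  {x | x.1 o = 0 ∧ (∀ j ≤ K, x.2.1 j = 0) ∧
    SparseClosed o K q l (p : ℤ) β (fun j => (x.1 j).val) (fun j => (x.2.1 j).val)
      (x.2.2.val : ℤ)}

theorem mul_val_lt_sq {p : ℕ} [NeZero p] (x : ZMod p) : (p : ℤ) * x.val < (p : ℤ) ^ 2 := by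
  have := x.val_lt
  have hp : 0 < p := NeZero.pos p
  rw [sq]; exact_mod_cast Nat.mul_lt_mul_of_pos_left this hp

theorem exists_zmod_val_eq {p : ℕ} [NeZero p] {z : ℤ} (h0 : 0 ≤ z) (h1 : z < (p : ℤ) ^ 2)
    (h2 : (p : ℤ) ∣ z) : ∃ x : ZMod p, z = p * x.val := by
  obtain ⟨y, rfl⟩ := h2
  have hp : (0 : ℤ) < p := by exact_mod_cast NeZero.pos p
  have hy : 0 ≤ y := nonneg_of_mul_nonneg_right h0 hp
  have hy' : y < p := by rw [sq] at h1; exact lt_of_mul_lt_mul_left h1 hp.le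
  exact ⟨(y : ZMod p), by rw [ZMod.val_intCast, Int.emod_eq_of_lt hy hy']⟩

theorem gComp_eq_card_sparseParams {m : ℕ} {o K q l : Fin m} {β : ℕ} {α : Fin m → ℕ} {p : ℕ}
    (h : IsSparseExponents o K q l β α) (hp : 1 < p) :
    gComp p α = Nat.card (sparseParams o K q l p β) := by
  have : NeZero p := ⟨by omega⟩
  have hp' : (p : ℤ) ≠ 0 := by exact_mod_cast NeZero.ne p
  have hβ : (p : ℤ) ^ β = p * (p ^ (β - 1) : ℕ) := by
    push_cast
    rw [← pow_succ', Nat.sub_add_cancel (by have := h.hβ; omega)]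
  symm
  have key : ∀ x ∈ sparseParams o K q l p β, IsIrreducibleSubringMatrix p α
      (borderedMatrix (sparseCol o K q l (p : ℤ) (fun i => (p : ℤ) ^ α i)
        (fun j => ((x.1 j).val : ℤ)) (fun j => ((x.2.1 j).val : ℤ)) (x.2.2.val : ℤ))) := by
    rintro ⟨a, b, c⟩ ⟨ha, hb, hx⟩
    have ha' : ((a o).val : ℤ) = 0 := by simp_all
    have hb' : ∀ j ≤ K, ((b j).val : ℤ) = 0 := fun j hj => by simp_all
    have hF := h.isSparseFrame (p := p) (a := fun j => ((a j).val : ℤ))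
      (b := fun j => ((b j).val : ℤ)) (NeZero.ne p) ha' hb'
    rw [isIrreducibleSubringMatrix_iff_exists hp h.ne_zero]
    refine ⟨_, rfl, fun i j hij => h.sparseCol_lower hb' hij,
      h.sparseCol_diag ha' hb', fun i j hij => ?_, hF.mul_mem_span_iff.2 hx⟩
    dsimp only
    rw [← and_assoc, and_iff_left (hF.dvd_col i j)]
    by_cases h0 : i = o
    · subst h0
      rw [h.sparseCol_o hij, h.α_o]
      exact ⟨by positivity, mul_val_lt_sq _⟩
    by_cases h1 : i = K
    · subst h1
      rw [h.sparseCol_K hij, h.α_K]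
      exact ⟨by positivity, mul_val_lt_sq _⟩
    by_cases h2 : i = q
    · subst h2
      obtain rfl := h.eq_l hij
      rw [h.sparseCol_q, h.α_q, hβ]
      refine ⟨by positivity, ?_⟩
      exact_mod_cast Nat.mul_lt_mul_of_pos_left c.isLt (NeZero.pos p)
    rw [IsSparseExponents.sparseCol_other hij.ne h0 h1 h2]
    exact ⟨le_rfl, pow_pos (by exact_mod_cast NeZero.pos p) _⟩
  refine Nat.card_eq_of_bijective (fun x => ⟨_, key x.1 x.2⟩) ⟨?_, ?_⟩
  · rintro ⟨⟨a, b, c⟩, ha, hb, hx⟩ ⟨⟨a', b', c'⟩, ha', hb', hx'⟩ heq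
    have hv := fun i j : Fin m => congrFun (congrFun (congrArg Subtype.val heq) i.castSucc)
      j.castSucc
    simp only [borderedMatrix.castSucc_castSucc] at hv ha hb ha' hb'
    have h1 : a = a' := by
      funext j
      by_cases hj : o = j
      · rw [← hj, ha, ha']
      have := hv o j
      rw [h.sparseCol_o (lt_of_le_of_ne (h.o_le j) hj),
        h.sparseCol_o (lt_of_le_of_ne (h.o_le j) hj)] at this
      exact ZMod.val_injective p (by exact_mod_cast mul_left_cancel₀ hp' this)
    have h2 : b = b' := by
      funext j
      rcases le_or_gt j K with hj | hj
      · rw [hb j hj, hb' j hj]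
      have := hv K j
      rw [h.sparseCol_K hj, h.sparseCol_K hj] at this
      exact ZMod.val_injective p (by exact_mod_cast mul_left_cancel₀ hp' this)
    have h3 : c = c' := by
      have := hv q l
      rw [h.sparseCol_q, h.sparseCol_q] at this
      exact Fin.ext (by exact_mod_cast mul_left_cancel₀ hp' this)
    subst h1 h2 h3; rfl
  · rintro ⟨A, hA⟩
    obtain ⟨v, rfl, v1, v2, v3, v4⟩ := (isIrreducibleSubringMatrix_iff_exists hp h.ne_zero).1 hA
    have ea : ∀ j, ∃ x : ZMod p, (j = o → x = 0) ∧ (o < j → v j o = p * x.val) := by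
      intro j
      by_cases hj : o < j
      · obtain ⟨x1, x2, x3⟩ := v3 o j hj
        rw [h.α_o] at x2
        obtain ⟨x, hx⟩ := exists_zmod_val_eq x1 x2 x3
        exact ⟨x, fun hj' => absurd hj' hj.ne', fun _ => hx⟩
      · exact ⟨0, fun _ => rfl, fun hj' => absurd hj' hj⟩
    have eb : ∀ j, ∃ x : ZMod p, (j ≤ K → x = 0) ∧ (K < j → v j K = p * x.val) := by
      intro j
      by_cases hj : K < j
      · obtain ⟨x1, x2, x3⟩ := v3 K j hj
        rw [h.α_K] at x2
        obtain ⟨x, hx⟩ := exists_zmod_val_eq x1 x2 x3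
        exact ⟨x, fun hj' => absurd hj' hj.not_ge, fun _ => hx⟩
      · exact ⟨0, fun _ => rfl, fun hj' => absurd hj' hj⟩
    choose a ha ha' using ea
    choose b hb hb' using eb
    obtain ⟨c, hc⟩ : ∃ c : Fin (p ^ (β - 1)), v l q = p * (c.val : ℤ) := by
      obtain ⟨x1, x2, y, hy⟩ := v3 q l h.q_lt_l
      have hp0 : (0 : ℤ) < p := by exact_mod_cast NeZero.pos p
      rw [h.α_q, hβ, hy] at x2
      rw [hy] at x1
      have y0 : 0 ≤ y := nonneg_of_mul_nonneg_right x1 hp0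
      have y1 : y < (p ^ (β - 1) : ℕ) := lt_of_mul_lt_mul_left x2 hp0.le
      lift y to ℕ using y0
      exact ⟨⟨y, by exact_mod_cast y1⟩, hy⟩
    have za : ((a o).val : ℤ) = 0 := by simp [ha o rfl]
    have zb : ∀ j ≤ K, ((b j).val : ℤ) = 0 := fun j hj => by simp [hb j hj]
    have hF := h.isSparseFrame (p := p) (a := fun j => ((a j).val : ℤ))
      (b := fun j => ((b j).val : ℤ)) (NeZero.ne p) za zb
    have hv : sparseCol o K q l (p : ℤ) (fun i => (p : ℤ) ^ α i)
        (fun j => ((a j).val : ℤ)) (fun j => ((b j).val : ℤ)) (c.val : ℤ) = v := by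
      funext j i
      rcases lt_trichotomy j i with hij | rfl | hij
      · rw [v1 i j hij, h.sparseCol_lower zb hij]
      · rw [v2, h.sparseCol_diag za zb]
      by_cases h0 : i = o
      · subst h0
        rw [h.sparseCol_o hij, ha' j hij]
      by_cases h1 : i = K
      · subst h1
        rw [h.sparseCol_K hij, hb' j hij]
      by_cases h2 : i = q
      · subst h2
        obtain rfl := h.eq_l hij
        rw [h.sparseCol_q, hc]
      rw [IsSparseExponents.sparseCol_other hij.ne h0 h1 h2]
      obtain ⟨x1, x2, x3⟩ := v3 i j hij
      rw [h.α_other i h0 h1 h2, pow_one] at x2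
      exact (Int.eq_zero_of_dvd_of_nonneg_of_lt x1 x2 x3).symm
    refine ⟨⟨⟨a, b, c⟩, ha o rfl, fun j hj => hb j hj, ?_⟩, ?_⟩
    · rw [← hF.mul_mem_span_iff, hv]; exact v4
    · exact Subtype.ext (congrArg borderedMatrix hv)

/-- The conditions of `SparseClosed` over the residue field, with the value `τ` of
`(c ^ 2 - c) / p ^ (β - 2)` given. The components of a member are the entries at `(o, K)`,
`(o, q)`, `(K, j)` for `j` strictly between `K` and `q`, `(K, q)` and `(K, l)`. -/
def residueParams (F J : Type*) [Field F] (τ : F) : Set (F × F × (J → F) × F × F) :=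
  {x | (x.1 = 0 ∧ τ * x.2.1 = 0 ∧ τ * x.2.2.2.1 = 0) ∨
    (x.1 ≠ 0 ∧ x.2.2.2.1 = 0 ∧ (∀ i j, i ≠ j → x.2.2.1 i * x.2.2.1 j = 0) ∧
      (∀ i, x.2.2.1 i ^ 2 - x.2.2.1 i = 0) ∧ (∀ i, x.2.2.1 i * x.2.2.2.2 = 0) ∧
      x.1 * (x.2.2.2.2 ^ 2 - x.2.2.2.2) + x.2.1 * τ = 0)}

section residueParams

variable {F J : Type*} [Field F] [DecidableEq J]

theorem exists_eq_single_or_eq_zero {f : J → F} {w : F} (h1 : ∀ i j, i ≠ j → f i * f j = 0)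
    (h2 : ∀ i, f i ^ 2 - f i = 0) (h3 : ∀ i, f i * w = 0) :
    (∃ i, f = Pi.single i 1 ∧ w = 0) ∨ f = 0 := by
  by_cases hf : f = 0
  · exact .inr hf
  obtain ⟨i, hi⟩ := Function.ne_iff.1 hf
  simp only [Pi.zero_apply] at hi
  refine .inl ⟨i, ?_, (mul_eq_zero.1 (h3 i)).resolve_left hi⟩
  funext j
  by_cases hj : j = i
  · subst hj
    have : f j * (f j - 1) = 0 := by linear_combination h2 j
    simpa [sub_eq_zero] using (mul_eq_zero.1 this).resolve_left hi
  · simpa [hj] using (mul_eq_zero.1 (h1 j i hj)).resolve_right hi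

theorem single_mul_single_eq_zero {i j k : J} (h : j ≠ k) :
    (Pi.single i 1 : J → F) j * (Pi.single i 1 : J → F) k = 0 := by
  by_cases hj : j = i
  · have hk : k ≠ i := fun hk => h (hj.trans hk.symm)
    simp [hk]
  · simp [hj]

theorem single_sq_sub_eq_zero (i j : J) :
    (Pi.single i 1 : J → F) j ^ 2 - (Pi.single i 1 : J → F) j = 0 := by
  by_cases hj : j = i
  · subst hj; simp
  · simp [hj]

variable [Fintype F] [Fintype J]

theorem card_residueParams_zero : Nat.card (residueParams F J 0) =
    Fintype.card F ^ (Fintype.card J + 3) +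
      (Fintype.card F - 1) * Fintype.card F * (Fintype.card J + 2) := by
  classical
  have e : Nat.card (((J → F) × F × F × F) ⊕ ({x : F // x ≠ 0} × F × (J ⊕ Bool))) =
      Fintype.card F ^ (Fintype.card J + 3) +
      (Fintype.card F - 1) * Fintype.card F * (Fintype.card J + 2) := by
    simp only [Nat.card_eq_fintype_card, Fintype.card_sum, Fintype.card_prod, Fintype.card_fun,
      Fintype.card_bool, Fintype.card_subtype_compl, Fintype.card_unique]
    ring
  rw [← e]
  symm
  refine Nat.card_eq_of_bijective (Sum.elim
    (fun x => ⟨(0, x.2.1, x.1, x.2.2.1, x.2.2.2), .inl ⟨rfl, by simp, by simp⟩⟩)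
    (fun x => Sum.elim
      (fun i => ⟨(x.1, x.2.1, Pi.single i 1, 0, 0), .inr ⟨x.1.2, rfl,
        fun _ _ => single_mul_single_eq_zero, single_sq_sub_eq_zero i, by simp, by simp⟩⟩)
      (fun s => ⟨(x.1, x.2.1, 0, 0, if s then 1 else 0), .inr ⟨x.1.2, rfl, by simp, by simp,
        by simp, by cases s <;> simp⟩⟩) x.2.2)) ⟨?_, ?_⟩
  · rintro (⟨f, y, z, w⟩ | ⟨⟨x, hx⟩, y, i | s⟩) (⟨f', y', z', w'⟩ | ⟨⟨x', hx'⟩, y', i' | s'⟩) h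
    all_goals
      replace h := congrArg Subtype.val h
      simp only [Sum.elim_inl, Sum.elim_inr, Prod.mk.injEq] at h
    · obtain ⟨-, rfl, rfl, rfl, rfl⟩ := h; rfl
    · exact absurd h.1.symm hx'
    · exact absurd h.1.symm hx'
    · exact absurd h.1 hx
    · obtain ⟨rfl, rfl, h, -⟩ := h
      obtain rfl : i = i' := by
        by_contra hi
        simpa [hi] using congrFun h i
      rfl
    · simpa using congrFun h.2.2.1 i
    · exact absurd h.1 hx
    · simpa using congrFun h.2.2.1 i'
    · obtain ⟨rfl, rfl, -, -, h⟩ := h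
      cases s <;> cases s' <;> simp_all
  · rintro ⟨⟨x, y, f, z, w⟩, ⟨hx, -, -⟩ | ⟨hx, hz, h1, h2, h3, h4⟩⟩
    · exact ⟨.inl ⟨f, y, z, w⟩, by simp only [Sum.elim_inl]; congr 2; exact hx.symm⟩
    simp only at hx hz h1 h2 h3 h4
    subst hz
    rcases exists_eq_single_or_eq_zero h1 h2 h3 with ⟨i, rfl, rfl⟩ | rfl
    · exact ⟨.inr ⟨⟨x, hx⟩, y, .inl i⟩, rfl⟩
    have hw : w * (w - 1) = 0 := by
      apply mul_left_cancel₀ hx; linear_combination h4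
    rcases mul_eq_zero.1 hw with rfl | hw
    · exact ⟨.inr ⟨⟨x, hx⟩, y, .inr false⟩, by simp⟩
    · obtain rfl := sub_eq_zero.1 hw
      exact ⟨.inr ⟨⟨x, hx⟩, y, .inr true⟩, by simp⟩

theorem card_residueParams_of_ne_zero {τ : F} (hτ : τ ≠ 0) : Nat.card (residueParams F J τ) =
    Fintype.card F ^ (Fintype.card J + 1) +
      (Fintype.card F - 1) * (Fintype.card J + Fintype.card F) := by
  classical
  have e : Nat.card (((J → F) × F) ⊕ ({x : F // x ≠ 0} × (J ⊕ F))) =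
      Fintype.card F ^ (Fintype.card J + 1) +
      (Fintype.card F - 1) * (Fintype.card J + Fintype.card F) := by
    simp only [Nat.card_eq_fintype_card, Fintype.card_sum, Fintype.card_prod, Fintype.card_fun,
      Fintype.card_subtype_compl, Fintype.card_unique]
    ring
  rw [← e]
  symm
  refine Nat.card_eq_of_bijective (Sum.elim
    (fun x => ⟨(0, 0, x.1, 0, x.2), .inl ⟨rfl, by simp, by simp⟩⟩)
    (fun x => Sum.elim
      (fun i => ⟨(x.1, 0, Pi.single i 1, 0, 0), .inr ⟨x.1.2, rfl,
        fun _ _ => single_mul_single_eq_zero, single_sq_sub_eq_zero i, by simp, by simp⟩⟩)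
      (fun w => ⟨(x.1, -(x.1 * (w ^ 2 - w)) * τ⁻¹, 0, 0, w), .inr ⟨x.1.2, rfl, by simp, by simp,
        by simp, by simp [hτ]⟩⟩) x.2)) ⟨?_, ?_⟩
  · rintro (⟨f, w⟩ | ⟨⟨x, hx⟩, i | w⟩) (⟨f', w'⟩ | ⟨⟨x', hx'⟩, i' | w'⟩) h
    all_goals
      replace h := congrArg Subtype.val h
      simp only [Sum.elim_inl, Sum.elim_inr, Prod.mk.injEq] at h
    · obtain ⟨-, -, rfl, -, rfl⟩ := h; rfl
    · exact absurd h.1.symm hx'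
    · exact absurd h.1.symm hx'
    · exact absurd h.1 hx
    · obtain ⟨rfl, -, h, -⟩ := h
      obtain rfl : i = i' := by
        by_contra hi
        simpa [hi] using congrFun h i
      rfl
    · simpa using congrFun h.2.2.1 i
    · exact absurd h.1 hx
    · simpa using congrFun h.2.2.1 i'
    · obtain ⟨rfl, -, -, -, rfl⟩ := h; rfl
  · rintro ⟨⟨x, y, f, z, w⟩, ⟨hx, hy, hz⟩ | ⟨hx, hz, h1, h2, h3, h4⟩⟩
    · simp only at hx hy hz
      obtain rfl := (mul_eq_zero.1 hy).resolve_left hτ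
      obtain rfl := (mul_eq_zero.1 hz).resolve_left hτ
      subst hx
      exact ⟨.inl ⟨f, w⟩, rfl⟩
    simp only at hx hz h1 h2 h3 h4
    subst hz
    rcases exists_eq_single_or_eq_zero h1 h2 h3 with ⟨i, rfl, rfl⟩ | rfl
    · obtain rfl : y = 0 := by simpa [hτ] using h4
      exact ⟨.inr ⟨⟨x, hx⟩, .inl i⟩, rfl⟩
    · obtain rfl : y = -(x * (w ^ 2 - w)) * τ⁻¹ := by
        field_simp; linear_combination h4
      exact ⟨.inr ⟨⟨x, hx⟩, .inr w⟩, rfl⟩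

end residueParams

theorem pow_dvd_sq_sub_iff {p : ℕ} (hp : p.Prime) (γ : ℕ) (c : ℤ) :
    (p : ℤ) ^ γ ∣ c ^ 2 - c ↔ (p : ℤ) ^ γ ∣ c ∨ (p : ℤ) ^ γ ∣ c - 1 := by
  have hpz := Nat.prime_iff_prime_int.1 hp
  rw [show c ^ 2 - c = c * (c - 1) by ring]
  refine ⟨fun h => ?_, fun h => h.elim (fun h => h.mul_right _) fun h => h.mul_left _⟩
  by_cases hc : (p : ℤ) ∣ c
  · left
    refine IsCoprime.dvd_of_dvd_mul_right ?_ h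
    refine IsCoprime.pow_left ((Prime.coprime_iff_not_dvd hpz).2 fun hc' => ?_)
    exact hpz.not_isUnit (isUnit_of_dvd_one (by simpa using dvd_sub hc hc'))
  · right
    exact IsCoprime.dvd_of_dvd_mul_left
      (IsCoprime.pow_left ((Prime.coprime_iff_not_dvd hpz).2 hc)) h

theorem pow_dvd_sq_sub_natCast_iff {p : ℕ} (hp : p.Prime) (γ c : ℕ) :
    (p : ℤ) ^ γ ∣ (c : ℤ) ^ 2 - c ↔ c ≡ 0 [MOD p ^ γ] ∨ c ≡ 1 [MOD p ^ γ] := by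
  rw [pow_dvd_sq_sub_iff hp, Nat.modEq_zero_iff_dvd, Nat.ModEq.comm (a := c) (b := 1),
    Nat.modEq_iff_dvd]
  norm_cast

theorem card_filter_pow_dvd_sq_sub {p : ℕ} (hp : p.Prime) {γ : ℕ} (hγ : γ ≠ 0) (δ : ℕ) :
    ((Finset.range (p ^ (γ + δ))).filter
      fun c : ℕ => (p : ℤ) ^ γ ∣ (c : ℤ) ^ 2 - c).card = 2 * p ^ δ := by
  have hpos : 0 < p ^ γ := pow_pos hp.pos _
  have count : ∀ v, ((Finset.range (p ^ (γ + δ))).filter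
      fun c : ℕ => c ≡ v [MOD p ^ γ]).card = p ^ δ := by
    intro v
    rw [← Nat.count_eq_card_filter_range, Nat.count_modEq_card _ hpos, pow_add]
    simp [hpos]
  simp_rw [pow_dvd_sq_sub_natCast_iff hp]
  rw [Finset.filter_or, Finset.card_union_of_disjoint, count, count, two_mul]
  rw [Finset.disjoint_filter]
  intro c _ h0 h1
  have h := h0.symm.trans h1
  have : p ^ γ ∣ 1 := (Nat.modEq_zero_iff_dvd.1 h.symm)
  exact (Nat.one_lt_pow hγ hp.one_lt).ne' (Nat.dvd_one.1 this)

theorem card_closed_pairs {p : ℕ} [Fact p.Prime] {J : Type*} [Fintype J] [DecidableEq J]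
    {β N : ℕ} (hβ : 2 ≤ β)
    (hN : ((Finset.range (p ^ (β - 1))).filter
      fun c : ℕ => (p : ℤ) ^ (β - 2) ∣ (c : ℤ) ^ 2 - c).card = N) :
    Nat.card {x : Fin (p ^ (β - 1)) × (ZMod p × ZMod p × (J → ZMod p) × ZMod p × ZMod p) //
      ∃ t : ℤ, (x.1.val : ℤ) ^ 2 - x.1.val = (p : ℤ) ^ (β - 2) * t ∧
        x.2 ∈ residueParams (ZMod p) J t} =
    2 * (p ^ (Fintype.card J + 3) + (p - 1) * p * (Fintype.card J + 2)) +
      (N - 2) * (p ^ (Fintype.card J + 1) + (p - 1) * (Fintype.card J + p)) := by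
  have hp : p.Prime := Fact.out
  have hp0 : (p : ℤ) ≠ 0 := by exact_mod_cast hp.ne_zero
  obtain ⟨γ, rfl⟩ : ∃ γ, β = γ + 2 := ⟨β - 2, by omega⟩
  simp only [Nat.add_sub_cancel, show γ + 2 - 1 = γ + 1 by omega] at hN ⊢
  set f₀ := p ^ (Fintype.card J + 3) + (p - 1) * p * (Fintype.card J + 2) with hf₀
  set f₁ := p ^ (Fintype.card J + 1) + (p - 1) * (Fintype.card J + p) with hf₁
  have fibre : ∀ c : ℕ,
      Nat.card {y : ZMod p × ZMod p × (J → ZMod p) × ZMod p × ZMod p //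
        ∃ t : ℤ, (c : ℤ) ^ 2 - c = (p : ℤ) ^ γ * t ∧ y ∈ residueParams (ZMod p) J t} =
      (if (p : ℤ) ^ (γ + 1) ∣ (c : ℤ) ^ 2 - c then f₀ else 0) +
      (if (p : ℤ) ^ γ ∣ (c : ℤ) ^ 2 - c ∧ ¬(p : ℤ) ^ (γ + 1) ∣ (c : ℤ) ^ 2 - c
        then f₁ else 0) := by
    intro c
    by_cases h : (p : ℤ) ^ γ ∣ (c : ℤ) ^ 2 - c
    · obtain ⟨t, ht⟩ := h
      have hpγ : (p : ℤ) ^ γ ≠ 0 := pow_ne_zero _ hp0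
      have e : ∀ y : ZMod p × ZMod p × (J → ZMod p) × ZMod p × ZMod p,
          (∃ t : ℤ, (c : ℤ) ^ 2 - c = (p : ℤ) ^ γ * t ∧ y ∈ residueParams (ZMod p) J t) ↔
            y ∈ residueParams (ZMod p) J t := by
        refine fun y => ⟨?_, fun hy => ⟨t, ht, hy⟩⟩
        rintro ⟨t', ht', hy⟩
        rwa [mul_left_cancel₀ hpγ (ht.symm.trans ht')]
      simp_rw [e, ht, pow_succ, mul_dvd_mul_iff_left hpγ, ← ZMod.intCast_zmod_eq_zero_iff_dvd]
      by_cases h0 : (t : ZMod p) = 0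
      · simp only [h0, dvd_mul_right, not_true, and_false, if_true, if_false, add_zero]
        simpa [ZMod.card] using card_residueParams_zero (F := ZMod p) (J := J)
      · simp only [h0, dvd_mul_right, not_false_eq_true, and_true, if_true, if_false, zero_add]
        simpa [ZMod.card] using card_residueParams_of_ne_zero (F := ZMod p) (J := J) h0
    · have h' : ¬(p : ℤ) ^ (γ + 1) ∣ (c : ℤ) ^ 2 - c := fun h' =>
        h ((pow_dvd_pow _ γ.le_succ).trans h')
      have : IsEmpty {y : ZMod p × ZMod p × (J → ZMod p) × ZMod p × ZMod p //
          ∃ t : ℤ, (c : ℤ) ^ 2 - c = (p : ℤ) ^ γ * t ∧ y ∈ residueParams (ZMod p) J t} :=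
        ⟨fun ⟨_, t, ht, _⟩ => h ⟨t, ht⟩⟩
      simp [h, h']
  refine (Nat.card_congr (Equiv.subtypeProdEquivSigmaSubtype
    fun (c : Fin (p ^ (γ + 1))) (y : ZMod p × ZMod p × (J → ZMod p) × ZMod p × ZMod p) =>
      ∃ t : ℤ, (c.val : ℤ) ^ 2 - c.val = (p : ℤ) ^ γ * t ∧ y ∈ residueParams (ZMod p) J t)).trans ?_
  rw [Nat.card_sigma]
  simp_rw [fibre]
  rw [Fin.sum_univ_eq_sum_range (fun c : ℕ =>
    (if (p : ℤ) ^ (γ + 1) ∣ (c : ℤ) ^ 2 - c then f₀ else 0) +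
      (if (p : ℤ) ^ γ ∣ (c : ℤ) ^ 2 - c ∧ ¬(p : ℤ) ^ (γ + 1) ∣ (c : ℤ) ^ 2 - c
        then f₁ else 0)), Finset.sum_add_distrib, ← Finset.sum_filter, ← Finset.sum_filter,
    Finset.sum_const, Finset.sum_const, smul_eq_mul, smul_eq_mul]
  have two := card_filter_pow_dvd_sq_sub hp γ.succ_ne_zero 0
  simp only [add_zero, pow_zero, mul_one, Nat.succ_eq_add_one] at two
  rw [two]
  congr 2
  rw [← hN, Finset.filter_and_not, Finset.card_sdiff_of_subset, two]
  exact Finset.monotone_filter_right _ fun c _ h => (pow_dvd_pow _ γ.le_succ).trans h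

namespace IsSparseExponents

variable {m : ℕ} {o K q l : Fin m} {β : ℕ} {α : Fin m → ℕ} {p : ℕ}

theorem sparseClosed_iff [Fact p.Prime] (h : IsSparseExponents o K q l β α)
    {a b : Fin m → ZMod p} (hb : ∀ j ≤ K, b j = 0) (c : ℤ) :
    SparseClosed o K q l (p : ℤ) β (fun j => (a j).val) (fun j => (b j).val) c ↔
      ∃ t : ℤ, c ^ 2 - c = (p : ℤ) ^ (β - 2) * t ∧
        (a K, a q, fun j : {j : Fin m // K < j ∧ j < q} => b j, b q, b l) ∈
          residueParams (ZMod p) {j : Fin m // K < j ∧ j < q} t := by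
  have hp0 : (p : ℤ) ≠ 0 := by exact_mod_cast (Fact.out : p.Prime).ne_zero
  have ne : ∀ i : {j : Fin m // K < j ∧ j < q},
      i.1 ≠ o ∧ i.1 ≠ K ∧ i.1 ≠ q ∧ i.1 ≠ l := fun i =>
    ⟨((h.o_le K).trans_lt i.2.1).ne', i.2.1.ne', i.2.2.ne, (i.2.2.trans h.q_lt_l).ne⟩
  constructor
  · rintro ⟨h1, h2, -, h4, h5, -, t, s, e1, e2, e3⟩
    simp only [← ZMod.intCast_zmod_eq_zero_iff_dvd, Int.cast_mul, Int.cast_sub, Int.cast_add,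
      Int.cast_pow, Int.cast_natCast, ZMod.natCast_zmod_val] at h1 h2 h4 h5 e3
    refine ⟨t, e1, ?_⟩
    by_cases ha : a K = 0
    · refine .inl ⟨ha, ?_, ?_⟩
      · simpa [ha, mul_comm] using e3
      · have := congrArg (Int.cast : ℤ → ZMod p) e2
        simp only [Int.cast_mul, Int.cast_sub, Int.cast_add, Int.cast_pow, Int.cast_natCast,
          ZMod.natCast_zmod_val, CharP.cast_eq_zero] at this
        linear_combination -this
    · have hq : b q = 0 := by simpa [ha] using h5
      refine .inr ⟨ha, hq, fun i j hij => ?_, fun i => ?_, fun i => ?_, ?_⟩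
      · obtain ⟨i0, i1, i2, i3⟩ := ne i
        obtain ⟨j0, j1, j2, j3⟩ := ne j
        exact (mul_eq_zero.1 (h1 i j (fun hh => hij (Subtype.ext hh)) i0 i1 i2 i3 j0 j1 j2
          j3)).resolve_left ha
      · obtain ⟨i0, i1, i2, i3⟩ := ne i
        exact (mul_eq_zero.1 (h2 i i0 i1 i2 i3)).resolve_left ha
      · obtain ⟨i0, i1, i2, i3⟩ := ne i
        exact (mul_eq_zero.1 (h4 i i0 i1 i2 i3)).resolve_left ha
      · have hs : (((b l).val : ℤ) ^ 2 - (b l).val) = s := by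
          apply mul_left_cancel₀ hp0; simpa [hq] using e2
        rw [← hs] at e3
        simpa using e3
  · rintro ⟨t, e1, ⟨ha, hy, hz⟩ | ⟨ha, hz, h1, h2, h3, h4⟩⟩
    · simp only at ha hy hz
      have hz' : (p : ℤ) ∣ (b q).val * t := by
        rw [← ZMod.intCast_zmod_eq_zero_iff_dvd]; simpa [mul_comm] using hz
      obtain ⟨z, hz'⟩ := hz'
      have dvd : ∀ y, (p : ℤ) ∣ ((a K).val : ℤ) * y := by simp [ha]
      refine ⟨fun _ _ _ _ _ _ _ _ _ _ _ => dvd _, fun _ _ _ _ _ => dvd _,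
        fun _ _ _ _ _ => dvd _, fun _ _ _ _ _ => dvd _, dvd _, dvd _, t,
        (b l).val ^ 2 - (b l).val - z, e1, by rw [hz']; ring, ?_⟩
      rw [← ZMod.intCast_zmod_eq_zero_iff_dvd]; simpa [ha, mul_comm] using hy
    · simp only at ha hz h1 h2 h3 h4
      have dich : ∀ i, i ≠ q → i ≠ l → b i = 0 ∨ (K < i ∧ i < q) := by
        intro i i2 i3
        rcases le_or_gt i K with hi | hi
        · exact .inl (hb i hi)
        · exact .inr ⟨hi, lt_of_le_of_ne (not_lt.1 fun hq => i3 (h.eq_l hq)) i2⟩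
      constructor
      · intro i j hij i0 i1 i2 i3 j0 j1 j2 j3
        rw [← ZMod.intCast_zmod_eq_zero_iff_dvd]
        rcases dich i i2 i3 with hi | hi
        · simp [hi]
        rcases dich j j2 j3 with hj | hj
        · simp [hj]
        simpa [ha] using h1 ⟨i, hi⟩ ⟨j, hj⟩ (by simpa using hij)
      · intro i i0 i1 i2 i3
        rw [← ZMod.intCast_zmod_eq_zero_iff_dvd]
        rcases dich i i2 i3 with hi | hi
        · simp [hi]
        simpa [ha] using h2 ⟨i, hi⟩
      · simp [hz]
      · intro i i0 i1 i2 i3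
        rw [← ZMod.intCast_zmod_eq_zero_iff_dvd]
        rcases dich i i2 i3 with hi | hi
        · simp [hi]
        simpa [ha] using h3 ⟨i, hi⟩
      · simp [hz]
      · simp [hz]
      · refine ⟨t, (b l).val ^ 2 - (b l).val, e1, by simp [hz], ?_⟩
        rw [← ZMod.intCast_zmod_eq_zero_iff_dvd]
        simpa using h4

theorem card_sparseParams_eq_mul [Fact p.Prime] (h : IsSparseExponents o K q l β α) :
    Nat.card (sparseParams o K q l p β) =
      p ^ (m - 3) * Nat.card {x : Fin (p ^ (β - 1)) ×
          (ZMod p × ZMod p × ({j : Fin m // K < j ∧ j < q} → ZMod p) × ZMod p × ZMod p) //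
        ∃ t : ℤ, (x.1.val : ℤ) ^ 2 - x.1.val = (p : ℤ) ^ (β - 2) * t ∧
          x.2 ∈ residueParams (ZMod p) {j : Fin m // K < j ∧ j < q} t} := by
  have oK := h.o_lt_K
  have Kq := h.K_lt_q
  have ql := h.q_lt_l
  have free : Nat.card ({j : Fin m // j ≠ o ∧ j ≠ K ∧ j ≠ q} → ZMod p) = p ^ (m - 3) := by
    rw [Nat.card_eq_fintype_card, Fintype.card_fun, ZMod.card, Fintype.card_subtype]
    congr 1
    have : (Finset.univ.filter fun j : Fin m => j ≠ o ∧ j ≠ K ∧ j ≠ q) = {o, K, q}ᶜ := by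
      ext; simp
    rw [this, Finset.card_compl, Fintype.card_fin,
      Finset.card_eq_three.2 ⟨o, K, q, oK.ne, (oK.trans Kq).ne, Kq.ne, rfl⟩]
  rw [← free, ← Nat.card_prod]
  refine Nat.card_eq_of_bijective (fun x =>
    ⟨fun j => x.1.1 j, ⟨(x.1.2.2, x.1.1 K, x.1.1 q, fun j => x.1.2.1 j, x.1.2.1 q, x.1.2.1 l),
      (h.sparseClosed_iff x.2.2.1 _).1 x.2.2.2⟩⟩) ⟨?_, ?_⟩
  · rintro ⟨⟨a, b, c⟩, ha, hb, hx⟩ ⟨⟨a', b', c'⟩, ha', hb', hx'⟩ heq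
    simp only at ha hb ha' hb'
    simp only [Prod.mk.injEq, Subtype.mk.injEq] at heq
    obtain ⟨h1, h2, h3, h4, h5, h6, h7⟩ := heq
    have hA : a = a' := by
      funext j
      by_cases j0 : j = o
      · rw [j0, ha, ha']
      by_cases j1 : j = K
      · rw [j1, h3]
      by_cases j2 : j = q
      · rw [j2, h4]
      exact congrFun h1 ⟨j, j0, j1, j2⟩
    have hB : b = b' := by
      funext j
      rcases le_or_gt j K with hj | hj
      · rw [hb j hj, hb' j hj]
      rcases lt_trichotomy j q with hj' | rfl | hj'
      · exact congrFun h5 ⟨j, hj, hj'⟩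
      · exact h6
      · rw [h.eq_l hj', h7]
    subst hA hB h2; rfl
  · rintro ⟨f, ⟨c, x, y, g, z, w⟩, hx⟩
    let a : Fin m → ZMod p := fun j => if j0 : j = o then 0 else if j1 : j = K then x else
      if j2 : j = q then y else f ⟨j, j0, j1, j2⟩
    let b : Fin m → ZMod p := fun j => if hj : K < j ∧ j < q then g ⟨j, hj⟩ else
      if j = q then z else if j = l then w else 0
    have ha : a o = 0 := by simp [a]
    have hb : ∀ j ≤ K, b j = 0 := by
      intro j hj
      simp [b, hj.not_gt, (hj.trans_lt Kq).ne, (hj.trans_lt (Kq.trans ql)).ne]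
    have aK : a K = x := by simp [a, oK.ne']
    have aq : a q = y := by simp [a, (oK.trans Kq).ne', Kq.ne']
    have bq : b q = z := by simp [b]
    have bl : b l = w := by simp [b, ql.ne', ql.not_gt]
    have bJ : (fun j : {j : Fin m // K < j ∧ j < q} => b j) = g := by
      funext j; simp [b, j.2]
    have af : (fun j : {j : Fin m // j ≠ o ∧ j ≠ K ∧ j ≠ q} => a j) = f := by
      funext j; simp [a, j.2.1, j.2.2.1, j.2.2.2]
    refine ⟨⟨⟨a, b, c⟩, ha, hb, ?_⟩, ?_⟩
    · rw [h.sparseClosed_iff hb]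
      dsimp only
      rw [aK, aq, bq, bl, bJ]
      exact hx
    · simp only [aK, aq, bq, bl, bJ, af]

theorem gComp_eq (h : IsSparseExponents o K q l β α) (hp : p.Prime) {N : ℕ}
    (hN : ((Finset.range (p ^ (β - 1))).filter
      fun c : ℕ => (p : ℤ) ^ (β - 2) ∣ (c : ℤ) ^ 2 - c).card = N) :
    gComp p α = p ^ (m - 3) *
      (2 * (p ^ (q.val - K.val - 1 + 3) + (p - 1) * p * (q.val - K.val - 1 + 2)) +
        (N - 2) * (p ^ (q.val - K.val - 1 + 1) + (p - 1) * (q.val - K.val - 1 + p))) := by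
  have : Fact p.Prime := ⟨hp⟩
  have hJ : Fintype.card {j : Fin m // K < j ∧ j < q} = q.val - K.val - 1 := by
    rw [Fintype.card_subtype, ← Fin.card_Ioo]
    congr 1; ext; simp
  rw [gComp_eq_card_sparseParams h hp.one_lt, h.card_sparseParams_eq_mul,
    card_closed_pairs h.hβ hN, hJ]

end IsSparseExponents

theorem g_two_ones_two_ones_beta_one (p : ℕ) (hp : p.Prime) (n : ℕ) (hn : 5 ≤ n)
    (k : ℕ) (hk1 : 2 ≤ k) (hk2 : k ≤ n - 3) (β : ℕ) (hβ : 2 ≤ β) :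
    (β = 2 →
      gComp p (fun i : Fin (n - 1) =>
          if i.val = 0 then 2 else if i.val = k - 1 then 2 else
            if i.val = n - 3 then β else 1) =
        2 * p ^ (n - 3 + (n - 1 - k)) + p ^ (n - 5 + (n - 1 - k)) * (p - 2) +
          2 * (n - 1 - k) * p ^ (n - 3) * (p - 1) +
          p ^ (n - 4) * (p - 1) * (p - 2) * (p + (n - 1 - k) - 2)) ∧
    (3 ≤ β →
      gComp p (fun i : Fin (n - 1) =>
          if i.val = 0 then 2 else if i.val = k - 1 then 2 else
            if i.val = n - 3 then β else 1) =
        2 * p ^ (n - 3 + (n - 1 - k)) + 2 * p ^ (n - 5 + (n - 1 - k)) * (p - 1) +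
          2 * (n - 1 - k) * p ^ (n - 3) * (p - 1) +
          2 * p ^ (n - 4) * (p - 1) ^ 2 * (p + (n - 1 - k) - 2)) := by
  have exps : IsSparseExponents (m := n - 1) ⟨0, by omega⟩ ⟨k - 1, by omega⟩ ⟨n - 3, by omega⟩
      ⟨n - 2, by omega⟩ β (fun i : Fin (n - 1) =>
          if i.val = 0 then 2 else if i.val = k - 1 then 2 else
            if i.val = n - 3 then β else 1) :=
    { o_val := rfl
      o_lt_K := Fin.lt_def.2 (by dsimp only; omega)
      K_lt_q := Fin.lt_def.2 (by dsimp only; omega)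
      q_val := by dsimp only; omega
      l_val := by dsimp only; omega
      hβ := hβ
      α_o := by simp
      α_K := by simp
      α_q := by
        dsimp only
        rw [if_neg (by omega), if_neg (by omega), if_pos rfl]
      α_other := by
        intro i h0 h1 h2
        simp only [ne_eq, Fin.ext_iff] at h0 h1 h2
        simp [h0, h1, h2] }
  obtain ⟨P, rfl⟩ : ∃ P, p = P + 2 := ⟨p - 2, by have := hp.two_le; omega⟩
  obtain ⟨k', rfl⟩ : ∃ k', k = k' + 2 := ⟨k - 2, by omega⟩
  obtain ⟨s, rfl⟩ : ∃ s, n = k' + s + 5 := ⟨n - (k' + 5), by omega⟩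
  have e1 : k' + s + 5 - 1 - 3 = k' + s + 1 := by omega
  have e2 : k' + s + 5 - 3 - (k' + 2 - 1) - 1 = s := by omega
  have e3 : k' + s + 5 - 3 = k' + s + 2 := by omega
  have e4 : k' + s + 5 - 1 - (k' + 2) = s + 2 := by omega
  have e5 : k' + s + 5 - 5 = k' + s := by omega
  have e6 : k' + s + 5 - 4 = k' + s + 1 := by omega
  have e7 : P + 2 + (s + 2) - 2 = P + s + 2 := by omega
  have e8 : P + 2 - 1 = P + 1 := by omega
  constructor
  · rintro rfl
    rw [exps.gComp_eq hp (N := P + 2) (by simp)]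
    dsimp only
    rw [e1, e2, e3, e4, e5, e6, e7, e8, Nat.add_sub_cancel]
    ring
  · intro hβ3
    have hN := card_filter_pow_dvd_sq_sub hp (γ := β - 2) (by omega) 1
    rw [show β - 2 + 1 = β - 1 by omega, pow_one] at hN
    rw [exps.gComp_eq hp hN]
    dsimp only
    rw [e1, e2, e3, e4, e5, e6, e7, e8, show 2 * (P + 2) - 2 = 2 * (P + 1) by omega]
    ring
end
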